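/- arXiv:1909.12628 — 2 statements merged into one kernel-verified Lean document; each statement's English description precedes it below -/
import Mathlib

section
/- Let τ = τ_ω be the end tangle of an end ω of G and k ∈ ℕ. If deg(ω) + dom(ω) < k, then τ ∩ S⃗_k is not closed: the separation (V, D), where D is the set of vertices dominating ω, lies in S⃗_k ∖ τ but agrees on every finite Z ⊆ V with some separation in τ ∩ S⃗_k. -/
open Set

universe u

/-- A separation of a graph `G`: a pair of vertex sets covering `V` with no
edge between `A \ B` and `B \ A`. -/
structure Separation {V : Type u} (G : SimpleGraph V) where
  A : Set V
  B : Set V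
  union_eq : A ∪ B = Set.univ
  no_edge : ∀ a ∈ A \ B, ∀ b ∈ B \ A, ¬ G.Adj a b

/-- The oriented separations of finite order. -/
abbrev FinSep {V : Type u} (G : SimpleGraph V) := {s : Separation G // (s.A ∩ s.B).Finite}

/-- The separation topology: basic open sets prescribe the restriction of a
separation to a finite vertex set `Z`. -/
instance sepTop {V : Type u} (G : SimpleGraph V) : TopologicalSpace (FinSep G) :=
  TopologicalSpace.generateFrom
    {O | ∃ Z AZ BZ : Set V, Z.Finite ∧
      O = {s : FinSep G | s.1.A ∩ Z = AZ ∧ s.1.B ∩ Z = BZ}}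

/-- The reverse orientation of a finite-order separation. -/
def FinSep.rev {V : Type u} {G : SimpleGraph V} (s : FinSep G) : FinSep G :=
  ⟨⟨s.1.B, s.1.A, by rw [Set.union_comm]; exact s.1.union_eq,
    fun a ha b hb h => s.1.no_edge b hb a ha h.symm⟩,
   by rw [Set.inter_comm]; exact s.2⟩

/-- A ray in a graph: an injective sequence of successively adjacent vertices. -/
structure GraphRay {V : Type u} (G : SimpleGraph V) where
  f : ℕ → V
  inj : Function.Injective f
  adj : ∀ n, G.Adj (f n) (f (n + 1))

/-- Two rays are equivalent if no finite vertex set separates them. -/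
def RayEquiv {V : Type u} (G : SimpleGraph V) (R R' : GraphRay G) : Prop :=
  ∀ F : Set V, F.Finite →
    ∃ (m n : ℕ) (w : G.Walk (R.f m) (R'.f n)), ∀ x ∈ w.support, x ∉ F

/-- An end of a graph: a (nonempty) equivalence class of rays. -/
structure GraphEnd {V : Type u} (G : SimpleGraph V) where
  rays : Set (GraphRay G)
  nonempty : rays.Nonempty
  mem_iff : ∀ R ∈ rays, ∀ R', R' ∈ rays ↔ RayEquiv G R R'

/-- A ray has a tail in `B`. -/
def HasTailIn {V : Type u} {G : SimpleGraph V} (R : GraphRay G) (B : Set V) : Prop :=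
  ∃ N, ∀ n ≥ N, R.f n ∈ B

/-- The end tangle induced by the end `ω`: all finite-order separations `(A,B)`
such that every ray of `ω` has a tail in `B`. -/
def endTangle {V : Type u} {G : SimpleGraph V} (ω : GraphEnd G) : Set (FinSep G) :=
  {s | ∀ R ∈ ω.rays, HasTailIn R s.1.B}

/-- `v` dominates the end `ω`: `v` sends infinitely many paths to a ray of `ω`
which pairwise meet only in `v`. -/
def Dominates {V : Type u} (G : SimpleGraph V) (v : V) (ω : GraphEnd G) : Prop :=
  ∃ R ∈ ω.rays, ∃ p : ℕ → (n : ℕ) × G.Walk v (R.f n),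
    (∀ i, (p i).2.IsPath) ∧ (Function.Injective fun i => (p i).1) ∧
    ∀ i j, i ≠ j → ∀ x, x ∈ (p i).2.support → x ∈ (p j).2.support → x = v

/-- The end `ω` has (vertex) degree at least `m`: there are `m` pairwise
disjoint rays belonging to `ω`. -/
def DegGE {V : Type u} (G : SimpleGraph V) (ω : GraphEnd G) (m : ℕ) : Prop :=
  ∃ R : Fin m → GraphRay G, (∀ i, R i ∈ ω.rays) ∧
    ∀ i j, i ≠ j → Disjoint (Set.range (R i).f) (Set.range (R j).f)

/-- At least `n` vertices dominate `ω`. -/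
def DomGE {V : Type u} (G : SimpleGraph V) (ω : GraphEnd G) (n : ℕ) : Prop :=
  ∃ D : Finset V, D.card = n ∧ ∀ v ∈ D, Dominates G v ω

/-- `deg(ω) + dom(ω) ≥ k`. -/
def DegDomGE {V : Type u} (G : SimpleGraph V) (ω : GraphEnd G) (k : ℕ) : Prop :=
  ∃ m n, m + n = k ∧ DegGE G ω m ∧ DomGE G ω n

/-- `T` separates `X` from the end `ω`: every ray of `ω` meeting `X` meets `T`. -/
def SeparatesFromEnd {V : Type u} (G : SimpleGraph V) (X T : Set V) (ω : GraphEnd G) : Prop :=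
  ∀ R ∈ ω.rays, (∃ n, R.f n ∈ X) → ∃ n, R.f n ∈ T

/-- `K` is `(<ℵ₀)`-inseparable (apart from the infiniteness requirement): no
finite-order separation separates two of its vertices. -/
def FinInseparable {V : Type u} (G : SimpleGraph V) (K : Set V) : Prop :=
  ∀ s : FinSep G, ∀ x ∈ K, ∀ y ∈ K, ¬(x ∈ s.1.A \ s.1.B ∧ y ∈ s.1.B \ s.1.A)

/-- An `ℵ₀`-block: a maximal infinite set of vertices no two of which can be
separated by a finite-order separation. -/
def Aleph0Block {V : Type u} (G : SimpleGraph V) (K : Set V) : Prop :=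
  K.Infinite ∧ FinInseparable G K ∧
    ∀ K' : Set V, K ⊆ K' → K'.Infinite → FinInseparable G K' → K' = K

/-- `u` and `v` are joined by a walk avoiding `F`. -/
def AvoidConn {V : Type u} (G : SimpleGraph V) (F : Set V) (a b : V) : Prop :=
  ∃ w : G.Walk a b, ∀ x ∈ w.support, x ∉ F

/-- The vertices joined to all late terms of `r` by walks avoiding `F`. -/
def tailComp {V : Type u} (G : SimpleGraph V) (r : ℕ → V) (F : Set V) : Set V :=
  {v | ∃ N, ∀ n ≥ N, AvoidConn G F v (r n)}

namespace AvoidConn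

variable {V : Type u} {G : SimpleGraph V} {F F' : Set V} {a b c : V}

theorem refl (h : a ∉ F) : AvoidConn G F a a :=
  ⟨.nil, by simpa using h⟩

theorem symm (h : AvoidConn G F a b) : AvoidConn G F b a := by
  obtain ⟨w, hw⟩ := h
  exact ⟨w.reverse, by simpa using hw⟩

theorem trans (h : AvoidConn G F a b) (h' : AvoidConn G F b c) : AvoidConn G F a c := by
  obtain ⟨w, hw⟩ := h
  obtain ⟨w', hw'⟩ := h'
  refine ⟨w.append w', fun x hx => ?_⟩
  rcases (SimpleGraph.Walk.mem_support_append_iff _ _).1 hx with hx | hx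
  exacts [hw x hx, hw' x hx]

theorem of_adj (h : G.Adj a b) (ha : a ∉ F) (hb : b ∉ F) : AvoidConn G F a b :=
  ⟨.cons h .nil, by simp [ha, hb]⟩

theorem mono (h : AvoidConn G F a b) (hF : F' ⊆ F) : AvoidConn G F' a b := by
  obtain ⟨w, hw⟩ := h
  exact ⟨w, fun x hx hxF => hw x hx (hF hxF)⟩

theorem left_notMem (h : AvoidConn G F a b) : a ∉ F := by
  obtain ⟨w, hw⟩ := h
  exact hw a w.start_mem_support

end AvoidConn

/-- A vertex set closed under stepping backwards along a walk contains its start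
as soon as it contains its end. -/
theorem SimpleGraph.Walk.start_mem_of_closed {V : Type u} {G : SimpleGraph V} {S : Set V}
    {a b : V} (w : G.Walk a b) (hb : b ∈ S)
    (hS : ∀ c ∈ S, ∀ x ∈ w.support, G.Adj x c → x ∈ S) : a ∈ S := by
  induction w with
  | nil => exact hb
  | cons h p ih =>
    refine hS _ (ih hb fun c hc x hx => hS c hc x ?_) _ (by simp) h
    simp [hx]

section TailComp

variable {V : Type u} {G : SimpleGraph V} {r : ℕ → V} {F : Set V}

theorem notMem_of_mem_tailComp {v : V} (h : v ∈ tailComp G r F) : v ∉ F := by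
  obtain ⟨N, hN⟩ := h
  exact (hN N le_rfl).left_notMem

theorem tailComp_of_conn {u v : V} (hv : v ∈ tailComp G r F) (h : AvoidConn G F u v) :
    u ∈ tailComp G r F := by
  obtain ⟨N, hN⟩ := hv
  exact ⟨N, fun n hn => h.trans (hN n hn)⟩

theorem tailComp_of_adj {u v : V} (hv : v ∈ tailComp G r F) (h : G.Adj u v) (hu : u ∉ F) :
    u ∈ tailComp G r F :=
  tailComp_of_conn hv (.of_adj h hu (notMem_of_mem_tailComp hv))

theorem conn_of_mem_tailComp {u v : V} (hu : u ∈ tailComp G r F) (hv : v ∈ tailComp G r F) :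
    AvoidConn G F u v := by
  obtain ⟨N, hN⟩ := hu
  obtain ⟨M, hM⟩ := hv
  exact (hN (max N M) (le_max_left _ _)).trans (hM (max N M) (le_max_right _ _)).symm

theorem tailComp_subset {C : Set V} (hr : ∃ N, ∀ n ≥ N, r n ∈ C)
    (hC : ∀ c ∈ C, ∀ x, G.Adj x c → x ∉ F → x ∈ C) : tailComp G r F ⊆ C := by
  rintro v ⟨N, hN⟩
  obtain ⟨M, hM⟩ := hr
  obtain ⟨w, hw⟩ := hN (max N M) (le_max_left _ _)
  exact w.start_mem_of_closed (hM _ (le_max_right _ _)) fun c hc x hx h => hC c hc x h (hw x hx)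

/-- Inside `tailComp G r F`, any two vertices are joined by a walk that stays there. -/
theorem conn_compl_tailComp {u v : V} (hu : u ∈ tailComp G r F) (hv : v ∈ tailComp G r F) :
    AvoidConn G (tailComp G r F)ᶜ u v := by
  classical
  obtain ⟨w, hw⟩ := conn_of_mem_tailComp hu hv
  refine ⟨w, fun x hx => not_not.2 (tailComp_of_conn hv ⟨w.dropUntil x hx, fun y hy => ?_⟩)⟩
  exact hw y (w.support_dropUntil_subset_support hx hy)

end TailComp

theorem GraphRay.eventually_notMem {V : Type u} {G : SimpleGraph V} (R : GraphRay G) {F : Set V}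
    (hF : F.Finite) : ∃ N, ∀ n ≥ N, R.f n ∉ F := by
  have h : (R.f ⁻¹' F).Finite := hF.preimage R.inj.injOn
  obtain ⟨N, hN⟩ := h.bddAbove
  exact ⟨N + 1, fun n hn hm => by have := hN hm; omega⟩

theorem GraphRay.tail_conn {V : Type u} {G : SimpleGraph V} (R : GraphRay G) {F : Set V}
    (hF : F.Finite) : ∃ N, ∀ m ≥ N, ∀ n ≥ N, AvoidConn G F (R.f m) (R.f n) := by
  obtain ⟨N, hN⟩ := R.eventually_notMem hF
  have h : ∀ n ≥ N, AvoidConn G F (R.f N) (R.f n) := by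
    intro n hn
    induction n, hn using Nat.le_induction with
    | base => exact .refl (hN N le_rfl)
    | succ n hn ih => exact ih.trans (.of_adj (R.adj n) (hN n hn) (hN _ (by omega)))
  exact ⟨N, fun m hm n hn => (h m hm).symm.trans (h n hn)⟩

theorem GraphEnd.hasTailIn_tailComp {V : Type u} {G : SimpleGraph V} {ω : GraphEnd G}
    {r R : GraphRay G} (hr : r ∈ ω.rays) (hR : R ∈ ω.rays) {F : Set V} (hF : F.Finite) :
    HasTailIn R (tailComp G r.f F) := by
  obtain ⟨N, hN⟩ := r.tail_conn hF
  obtain ⟨M, hM⟩ := R.tail_conn hF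
  obtain ⟨m, n, w, hw⟩ := (ω.mem_iff r hr R).1 hR (F ∪ (r.f '' Iio N ∪ R.f '' Iio M))
    (hF.union (((finite_Iio N).image _).union ((finite_Iio M).image _)))
  have hm : N ≤ m := by
    by_contra! hlt
    exact hw _ w.start_mem_support (.inr (.inl ⟨m, hlt, rfl⟩))
  have hn : M ≤ n := by
    by_contra! hlt
    exact hw _ w.end_mem_support (.inr (.inr ⟨n, hlt, rfl⟩))
  have hc : AvoidConn G F (r.f m) (R.f n) := AvoidConn.mono ⟨w, hw⟩ subset_union_left
  exact ⟨M, fun j hj => ⟨N, fun i hi => ((hM j hj n hn).trans hc.symm).trans (hN m hm i hi)⟩⟩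

theorem ray_mem_tailComp {V : Type u} {G : SimpleGraph V} {ω : GraphEnd G}
    {r : GraphRay G} (hr : r ∈ ω.rays) (T D : Finset V) :
    ∃ N, ∀ n ≥ N, r.f n ∈ tailComp G r.f (↑T ∪ ↑D) :=
  GraphEnd.hasTailIn_tailComp hr hr (T.finite_toSet.union D.finite_toSet)

/-- A vertex that no finite set can cut off from the end dominates it. -/
theorem dominates_of_forall_mem_tailComp {V : Type u} {G : SimpleGraph V} {ω : GraphEnd G}
    {r : GraphRay G} (hr : r ∈ ω.rays) {x : V}
    (hx : ∀ S : Set V, S.Finite → x ∉ S → x ∈ tailComp G r.f S) : Dominates G x ω := by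
  classical
  obtain ⟨p, hp⟩ := exists_seq_of_forall_finset_exists
    (fun p : (n : ℕ) × G.Walk x (r.f n) => p.2.IsPath)
    (fun p q => p.1 ≠ q.1 ∧ ∀ y, y ∈ p.2.support → y ∈ q.2.support → y = x) (by
      intro s _
      obtain ⟨N, hN⟩ := hx ((⋃ p ∈ s, {y | y ∈ p.2.support}) \ {x})
        ((s.finite_toSet.biUnion fun p _ => p.2.support.finite_toSet).sdiff) (by simp)
      obtain ⟨n, hn, hns⟩ := (Ici_infinite N).exists_notMem_finset (s.image Sigma.fst)
      obtain ⟨w, hw⟩ := hN n hn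
      refine ⟨⟨n, w.bypass⟩, w.bypass_isPath, fun p hp => ⟨?_, fun y hy hy' => ?_⟩⟩
      · rintro rfl
        exact hns (Finset.mem_image_of_mem _ hp)
      · by_contra hyx
        refine hw y (w.support_bypass_subset_support hy') ⟨?_, hyx⟩
        simp only [mem_iUnion]
        exact ⟨p, hp, hy⟩)
  refine ⟨r, hr, p, hp.1, fun i j hij => ?_, fun i j hij y hi hj => ?_⟩
  · by_contra hne
    rcases lt_or_gt_of_ne hne with h | h
    exacts [(hp.2 i j h).1 hij, (hp.2 j i h).1 hij.symm]
  · rcases lt_or_gt_of_ne hij with h | h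
    exacts [(hp.2 i j h).2 y hi hj, (hp.2 j i h).2 y hj hi]

/-- If every set of fewer than `k` points is missed by some member of a family of finite
sets, then this holds for a finite subfamily. -/
theorem exists_finset_subfamily {α : Type*} [DecidableEq α] (P : Set (Finset α)) (k : ℕ)
    (hP : ∀ Y : Finset α, Y.card < k → ∃ p ∈ P, Disjoint p Y) :
    ∃ Q : Finset (Finset α), ↑Q ⊆ P ∧ ∀ Y : Finset α, Y.card < k → ∃ p ∈ Q, Disjoint p Y := by
  classical
  suffices h : ∀ (j : ℕ) (Y₀ : Finset α), k ≤ Y₀.card + j → ∃ Q : Finset (Finset α), ↑Q ⊆ P ∧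
      ∀ Y : Finset α, Y₀ ⊆ Y → Y.card < k → ∃ p ∈ Q, Disjoint p Y by
    obtain ⟨Q, hQ, h⟩ := h k ∅ (by simp)
    exact ⟨Q, hQ, fun Y hY => h Y (by simp) hY⟩
  intro j
  induction j with
  | zero =>
    intro Y₀ h
    refine ⟨∅, by simp, fun Y hY hk => ?_⟩
    have := Finset.card_le_card hY
    omega
  | succ j ih =>
    intro Y₀ h
    by_cases hk : Y₀.card < k
    · obtain ⟨p, hp, hd⟩ := hP Y₀ hk
      have : ∀ x : α, ∃ Q : Finset (Finset α), x ∈ p → ↑Q ⊆ P ∧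
          ∀ Y : Finset α, insert x Y₀ ⊆ Y → Y.card < k → ∃ p ∈ Q, Disjoint p Y := by
        intro x
        by_cases hx : x ∈ p
        · obtain ⟨Q, hQ⟩ := ih (insert x Y₀) (by
            rw [Finset.card_insert_of_notMem (Finset.disjoint_left.1 hd hx)]; omega)
          exact ⟨Q, fun _ => hQ⟩
        · exact ⟨∅, fun h => absurd h hx⟩
      choose Q hQ using this
      refine ⟨insert p (p.biUnion Q), ?_, fun Y hY hYk => ?_⟩
      · intro q hq
        simp only [Finset.coe_insert, Finset.coe_biUnion, mem_insert_iff, mem_iUnion] at hq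
        rcases hq with rfl | ⟨x, hx, hq⟩
        exacts [hp, (hQ x hx).1 hq]
      · by_cases hpY : Disjoint p Y
        · exact ⟨p, by simp, hpY⟩
        · obtain ⟨x, hxp, hxY⟩ := Finset.not_disjoint_iff.1 hpY
          obtain ⟨q, hq, hqY⟩ := (hQ x hxp).2 Y (Finset.insert_subset hxY hY) hYk
          exact ⟨q, Finset.mem_insert_of_mem (Finset.mem_biUnion.2 ⟨x, hxp, hq⟩), hqY⟩
    · exact ⟨∅, by simp, fun Y hY hYk => absurd ((Finset.card_le_card hY).trans_lt hYk) hk⟩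

/-- A form of Menger's theorem: if no fewer than `#T` vertices of the finite set `W` meet all
walks in `W` from `T` to `T'`, then `W` carries `#T` disjoint `T`–`T'` paths, encoded by their
successor function (vertices off the paths may be fixed). -/
theorem exists_linkage {V : Type u} [DecidableEq V] (G : SimpleGraph V) {W T T' : Finset V}
    (h : ∀ Y : Finset V, Y.card < T.card → ∃ a ∈ T, ∃ b ∈ T', ∃ w : G.Walk a b,
      ∀ x ∈ w.support, x ∈ W ∧ x ∉ Y) :
    ∃ σ : V → V, InjOn σ ↑(W \ T') ∧ ∀ x ∈ W \ T', σ x ∈ W \ T ∧ (σ x = x ∨ G.Adj x (σ x)) := by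
  classical
  let t : {x // x ∈ W \ T'} → Finset V := fun x => {y ∈ W \ T | y = x ∨ G.Adj x y}
  have hall : ∀ s : Finset {x // x ∈ W \ T'}, s.card ≤ (s.biUnion t).card := by
    intro s
    let S : Finset V := s.map (.subtype _)
    have hSW : ∀ x ∈ S, x ∈ W ∧ x ∉ T' := by
      intro x hx
      obtain ⟨y, -, rfl⟩ := Finset.mem_map.1 hx
      exact Finset.mem_sdiff.1 y.2
    let N : Finset V := {y ∈ W \ S | ∃ x ∈ S, G.Adj x y}
    have hY : T.card ≤ (N ∪ (T \ S)).card := by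
      by_contra! hlt
      obtain ⟨a, ha, b, hb, w, hw⟩ := h _ hlt
      have haS : a ∈ S := by
        by_contra haS
        exact (hw a w.start_mem_support).2 (by simp [ha, haS])
      have : b ∈ (S : Set V) := by
        refine w.reverse.start_mem_of_closed (S := (S : Set V)) haS fun c hc x hx hadj => ?_
        rw [SimpleGraph.Walk.support_reverse, List.mem_reverse] at hx
        by_contra hxS
        refine (hw x hx).2 (Finset.mem_union_left _ ?_)
        exact Finset.mem_filter.2 ⟨Finset.mem_sdiff.2 ⟨(hw x hx).1, hxS⟩, c, hc, hadj.symm⟩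
      exact (hSW b this).2 hb
    have hsub : (S \ T) ∪ (N \ T) ⊆ s.biUnion t := by
      intro y hy
      rw [Finset.mem_biUnion]
      simp only [Finset.mem_union, Finset.mem_sdiff] at hy
      rcases hy with ⟨hy, hyT⟩ | ⟨hy, hyT⟩
      · obtain ⟨z, hz, rfl⟩ := Finset.mem_map.1 hy
        exact ⟨z, hz, Finset.mem_filter.2 ⟨Finset.mem_sdiff.2 ⟨(hSW _ hy).1, hyT⟩, .inl rfl⟩⟩
      · obtain ⟨hyW, x, hx, hadj⟩ := Finset.mem_filter.1 hy
        obtain ⟨z, hz, rfl⟩ := Finset.mem_map.1 hx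
        exact ⟨z, hz, Finset.mem_filter.2
          ⟨Finset.mem_sdiff.2 ⟨(Finset.mem_sdiff.1 hyW).1, hyT⟩, .inr hadj⟩⟩
    have hNS : Disjoint S N := Finset.disjoint_left.2 fun x hx hxN =>
      (Finset.mem_sdiff.1 (Finset.mem_filter.1 hxN).1).2 hx
    have h1 := Finset.card_le_card hsub
    rw [Finset.card_union_of_disjoint (hNS.mono Finset.sdiff_subset Finset.sdiff_subset)] at h1
    have h2 : (N ∪ (T \ S)).card ≤ (N \ T).card + (T \ S).card := by
      refine (Finset.card_le_card fun x hx => ?_).trans (Finset.card_union_le _ _)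
      have hxN : x ∈ S → x ∉ N := fun h => Finset.disjoint_left.1 hNS h
      simp only [Finset.mem_union, Finset.mem_sdiff] at hx ⊢
      tauto
    have h3 := Finset.card_sdiff_add_card_inter T S
    have h4 := Finset.card_sdiff_add_card_inter S T
    rw [Finset.inter_comm] at h4
    have h5 : S.card = s.card := Finset.card_map _
    omega
  obtain ⟨f, hf, hft⟩ := (Finset.all_card_le_biUnion_card_iff_exists_injective t).1 hall
  refine ⟨fun x => if hx : x ∈ W \ T' then f ⟨x, hx⟩ else x, fun x hx y hy hxy => ?_,
    fun x hx => ?_⟩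
  · rw [Finset.mem_coe] at hx hy
    simp only [hx, hy, dif_pos] at hxy
    exact congrArg Subtype.val (hf hxy)
  · simp only [hx, dif_pos]
    exact Finset.mem_filter.1 (hft ⟨x, hx⟩)

/-- In `G - D`, the finite set `T` separates `X` from the tails of `r`, avoiding `X`. -/
structure IsCut {V : Type u} (G : SimpleGraph V) (r : ℕ → V) (D X T : Finset V) : Prop where
  notMem_D : ∀ x ∈ T, x ∉ D
  notMem_X : ∀ x ∈ T, x ∉ X
  sep : ∀ x ∈ X, x ∉ tailComp G r (↑T ∪ ↑D)

/-- A cut of smallest size. -/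
structure IsMinCut {V : Type u} (G : SimpleGraph V) (r : ℕ → V) (D X T : Finset V) : Prop
    extends IsCut G r D X T where
  min : ∀ T', IsCut G r D X T' → T.card ≤ T'.card

section Cuts

variable {V : Type u} [DecidableEq V] {G : SimpleGraph V} {ω : GraphEnd G} {r : GraphRay G}
  {D X T T' : Finset V}

theorem exists_isCut (hr : r ∈ ω.rays) (hD : ∀ v, Dominates G v ω → v ∈ D)
    (hX : ∀ x ∈ X, x ∉ D) : ∃ T, IsCut G r.f D X T := by
  classical
  have : ∀ x : V, ∃ S : Set V, x ∈ X → S.Finite ∧ x ∉ S ∧ x ∉ tailComp G r.f S := by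
    intro x
    by_cases hx : x ∈ X
    · by_contra! hS
      exact hX x hx (hD x (dominates_of_forall_mem_tailComp hr fun S hf hxS => by
        obtain ⟨-, h⟩ := hS S
        exact h hf hxS))
    · exact ⟨∅, fun h => absurd h hx⟩
  choose S hS using this
  let F : Set V := (⋃ x ∈ X, S x) ∪ ↑X
  have hF : F.Finite := (X.finite_toSet.biUnion fun x hx => (hS x hx).1).union X.finite_toSet
  let C := tailComp G r.f (F ∪ ↑D)
  have hTF : {v | v ∉ C ∧ v ∉ D ∧ ∃ c ∈ C, G.Adj v c} ⊆ F := by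
    rintro v ⟨hv, hvD, c, hc, h⟩
    by_contra hvF
    exact hv (tailComp_of_adj hc h (by simp [hvF, hvD]))
  have hT := hF.subset hTF
  have hcoe : ∀ v, v ∈ hT.toFinset ↔ v ∉ C ∧ v ∉ D ∧ ∃ c ∈ C, G.Adj v c := fun v => by simp
  refine ⟨hT.toFinset, fun x hx => ((hcoe x).1 hx).2.1, fun x hx hxX => ?_, fun x hx hxC => ?_⟩
  · obtain ⟨-, -, c, ⟨N, hN⟩, hadj⟩ := (hcoe x).1 hx
    have hSF : S x ⊆ F ∪ ↑D := fun y hy => .inl (.inl (mem_biUnion hxX hy))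
    exact (hS x hxX).2.2 (tailComp_of_adj ⟨N, fun n hn => (hN n hn).mono hSF⟩ hadj (hS x hxX).2.1)
  · have hsub : tailComp G r.f (↑hT.toFinset ∪ ↑D) ⊆ C := by
      refine tailComp_subset (GraphEnd.hasTailIn_tailComp hr hr (hF.union D.finite_toSet)) ?_
      intro c hc v hadj hv
      by_contra hvC
      simp only [mem_union, Finset.mem_coe, hcoe, not_or] at hv
      exact hv.1 ⟨hvC, hv.2, c, hc, hadj⟩
    exact notMem_of_mem_tailComp (hsub hxC) (.inl (.inr hx))

theorem exists_isMinCut (hr : r ∈ ω.rays) (hD : ∀ v, Dominates G v ω → v ∈ D)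
    (hX : ∀ x ∈ X, x ∉ D) : ∃ T, IsMinCut G r.f D X T := by
  obtain ⟨T, hT, hmin⟩ := WellFounded.has_min (measure (Finset.card (α := V))).wf
    {T | IsCut G r.f D X T} (exists_isCut hr hD hX)
  exact ⟨T, hT, fun T' hT' => not_lt.1 (hmin T' hT')⟩

theorem IsCut.tailComp_subset (h : IsCut G r.f D (X ∪ T) T') (hr : r ∈ ω.rays) :
    tailComp G r.f (↑T' ∪ ↑D) ⊆ tailComp G r.f (↑T ∪ ↑D) := by
  intro v hv
  obtain ⟨N, hN⟩ := ray_mem_tailComp hr T' D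
  refine ⟨N, fun n hn => (conn_compl_tailComp hv (hN n hn)).mono ?_⟩
  rintro x (hx | hx) hxC
  · exact h.sep x (Finset.mem_union_right _ hx) hxC
  · exact notMem_of_mem_tailComp hxC (.inr hx)

theorem IsMinCut.subset_tailComp (h : IsMinCut G r.f D (X ∪ T) T') (hr : r ∈ ω.rays) :
    ∀ x ∈ T', x ∈ tailComp G r.f (↑T ∪ ↑D) := by
  classical
  have hC := h.toIsCut.tailComp_subset hr
  let U : Finset V := {x ∈ T' | x ∈ tailComp G r.f (↑T ∪ ↑D)}
  have hU : IsCut G r.f D (X ∪ T) U := by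
    refine ⟨fun x hx => h.notMem_D x (Finset.mem_filter.1 hx).1,
      fun x hx => h.notMem_X x (Finset.mem_filter.1 hx).1, fun x hx hxC => h.sep x hx ?_⟩
    refine _root_.tailComp_subset (ray_mem_tailComp hr T' D) (fun c hc u hadj hu => ?_) hxC
    by_contra huC
    have huD : u ∉ D := fun h => hu (.inr h)
    have huT' : u ∈ T' := by
      by_contra huT'
      exact huC (tailComp_of_adj hc hadj (by simp [huT', huD]))
    have huT : u ∉ T := fun h' => h.notMem_X u huT' (Finset.mem_union_right _ h')
    exact hu (.inl (Finset.mem_filter.2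
      ⟨huT', tailComp_of_adj (hC hc) hadj (by simp [huT, huD])⟩))
  intro x hx
  rw [← Finset.eq_of_subset_of_card_le (Finset.filter_subset _ _) (h.min U hU)] at hx
  exact (Finset.mem_filter.1 hx).2

/-- Between consecutive minimum cuts there is a linkage starting from all of `T`. -/
theorem IsMinCut.exists_linkage (h : IsMinCut G r.f D X T) (h' : IsMinCut G r.f D (X ∪ T) T')
    (hr : r ∈ ω.rays) : ∃ (W : Finset V) (σ : V → V), T ⊆ W ∧ T' ⊆ W ∧
      (∀ x ∈ W, (x ∈ tailComp G r.f (↑T ∪ ↑D) ∨ x ∈ T) ∧ x ∉ tailComp G r.f (↑T' ∪ ↑D)) ∧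
      InjOn σ ↑(W \ T') ∧ ∀ x ∈ W \ T', σ x ∈ W \ T ∧ (σ x = x ∨ G.Adj x (σ x)) := by
  classical
  have hC := h'.toIsCut.tailComp_subset hr
  have hT' := h'.subset_tailComp hr
  set C := tailComp G r.f (↑T ∪ ↑D)
  set C' := tailComp G r.f (↑T' ∪ ↑D)
  let E : Set V := {x | (x ∈ C ∨ x ∈ T) ∧ x ∉ C'}
  have hET : ∀ x ∈ T, x ∈ E := fun x hx => ⟨.inr hx, h'.sep x (Finset.mem_union_right _ hx)⟩
  have hET' : ∀ x ∈ T', x ∈ E := fun x hx =>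
    ⟨.inl (hT' x hx), fun hxC => notMem_of_mem_tailComp hxC (.inl hx)⟩
  let P : Set (Finset V) := {p | ∃ a ∈ T, ∃ b ∈ T', ∃ w : G.Walk a b,
    w.support.toFinset = p ∧ ∀ x ∈ w.support, x ∈ E}
  have hP : ∀ Y : Finset V, Y.card < T.card → ∃ p ∈ P, Disjoint p Y := by
    intro Y hY
    by_contra! hno
    let K : Set V := {v | ∃ b ∈ T', AvoidConn G (Eᶜ ∪ ↑Y) v b}
    have hKE : ∀ v ∈ K, v ∈ E := by
      rintro v ⟨b, -, hvb⟩
      by_contra hv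
      exact hvb.left_notMem (.inl hv)
    have hKT : ∀ v ∈ K, v ∉ T := by
      rintro v ⟨b, hb, w, hw⟩ hv
      refine hno w.support.toFinset ⟨v, hv, b, hb, w, rfl, fun x hx => ?_⟩
        (Finset.disjoint_left.2 fun x hx hxY => hw x (List.mem_toFinset.1 hx) (.inr hxY))
      by_contra hxE
      exact hw x hx (.inl hxE)
    have hcut : tailComp G r.f (↑(Y.filter fun x => x ∈ C ∨ x ∈ T) ∪ ↑D) ⊆ C' ∪ K := by
      refine _root_.tailComp_subset ?_ fun c hc u hadj hu => ?_
      · obtain ⟨N, hN⟩ := ray_mem_tailComp hr T' D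
        exact ⟨N, fun n hn => .inl (hN n hn)⟩
      · by_contra hun
        rw [mem_union, not_or] at hun
        have huD : u ∉ D := fun h => hu (.inr h)
        have huY : (u ∈ C ∨ u ∈ T) → u ∉ Y := fun h hY =>
          hu (.inl (Finset.mem_filter.2 ⟨hY, h⟩))
        rcases hc with hc | hc
        · have huT' : u ∈ T' := by
            by_contra huT'
            exact hun.1 (tailComp_of_adj hc hadj (by simp [huT', huD]))
          have huE := hET' u huT'
          exact hun.2 ⟨u, huT', .refl (by simp [huE, huY huE.1])⟩
        · have hcC : c ∈ C := (hKE c hc).1.resolve_right (hKT c hc)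
          have huCT : u ∈ C ∨ u ∈ T := by
            by_contra! hn
            exact hn.1 (tailComp_of_adj hcC hadj (by simp [hn.2, huD]))
          obtain ⟨b, hb, hcb⟩ := hc
          have huE : u ∈ E := ⟨huCT, hun.1⟩
          exact hun.2 ⟨b, hb, (AvoidConn.of_adj hadj (by simp [huE, huY huCT])
            hcb.left_notMem).trans hcb⟩
    have hXCT : ∀ x, (x ∈ C ∨ x ∈ T) → x ∉ X := by
      rintro x (hx | hx) hxX
      exacts [h.sep x hxX hx, h.notMem_X x hx hxX]
    refine absurd (h.min (Y.filter fun x => x ∈ C ∨ x ∈ T) ⟨fun x hx => ?_, fun x hx => ?_,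
      fun x hx hxC => ?_⟩) (not_le.2 ((Finset.card_filter_le _ _).trans_lt hY))
    · rcases (Finset.mem_filter.1 hx).2 with hx | hx
      exacts [fun hD => notMem_of_mem_tailComp hx (.inr hD), h.notMem_D x hx]
    · exact hXCT x (Finset.mem_filter.1 hx).2
    · rcases hcut hxC with hx' | hx'
      exacts [hXCT x (.inl (hC hx')) hx, hXCT x (hKE x hx').1 hx]
  obtain ⟨Q, hQP, hQ⟩ := exists_finset_subfamily P T.card hP
  let W : Finset V := T ∪ T' ∪ Q.biUnion id
  obtain ⟨σ, hσ⟩ := _root_.exists_linkage G (W := W) (T := T) (T' := T') (by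
    intro Y hY
    obtain ⟨p, hp, hpY⟩ := hQ Y hY
    obtain ⟨a, ha, b, hb, w, rfl, -⟩ := hQP hp
    refine ⟨a, ha, b, hb, w, fun x hx => ⟨?_, ?_⟩⟩
    · exact Finset.mem_union_right _ (Finset.mem_biUnion.2 ⟨_, hp, List.mem_toFinset.2 hx⟩)
    · exact Finset.disjoint_left.1 hpY (List.mem_toFinset.2 hx))
  refine ⟨W, σ, fun x hx => by simp [W, hx], fun x hx => by simp [W, hx], fun x hx => ?_, hσ⟩
  change x ∈ E
  simp only [W, Finset.mem_union, Finset.mem_biUnion] at hx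
  rcases hx with (hx | hx) | ⟨p, hp, hx⟩
  · exact hET x hx
  · exact hET' x hx
  · obtain ⟨a, ha, b, hb, w, rfl, hw⟩ := hQP hp
    exact hw x (List.mem_toFinset.1 hx)

/-- Every minimum cut starts an infinite sequence of consecutive minimum cuts. -/
theorem IsMinCut.exists_seq (h : IsMinCut G r.f D X T) (hr : r ∈ ω.rays)
    (hD : ∀ v, Dominates G v ω → v ∈ D) (hX : ∀ x ∈ X, x ∉ D) :
    ∃ X' T' : ℕ → Finset V, T' 0 = T ∧ (∀ n, IsMinCut G r.f D (X' n) (T' n)) ∧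
      ∀ n, X' (n + 1) = X' n ∪ T' n := by
  have step : ∀ p : {p : Finset V × Finset V // (∀ x ∈ p.1, x ∉ D) ∧ IsMinCut G r.f D p.1 p.2},
      ∃ q : {p : Finset V × Finset V // (∀ x ∈ p.1, x ∉ D) ∧ IsMinCut G r.f D p.1 p.2},
        q.1.1 = p.1.1 ∪ p.1.2 := by
    rintro ⟨⟨Y, S⟩, hY, hS⟩
    have hYS : ∀ x ∈ Y ∪ S, x ∉ D := by
      intro x hx
      rcases Finset.mem_union.1 hx with hx | hx
      exacts [hY x hx, hS.notMem_D x hx]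
    obtain ⟨S', hS'⟩ := exists_isMinCut hr hD hYS
    exact ⟨⟨⟨Y ∪ S, S'⟩, hYS, hS'⟩, rfl⟩
  choose g hg using step
  let s := fun n : ℕ => g^[n] ⟨(X, T), hX, h⟩
  refine ⟨fun n => (s n).1.1, fun n => (s n).1.2, rfl, fun n => (s n).2.2, fun n => ?_⟩
  change (s (n + 1)).1.1 = _
  simp only [s, Function.iterate_succ_apply']
  exact hg _

end Cuts

/-- An injective self-map of `S` moving vertices along edges or not at all yields a ray
from every point of `S` outside its image; distinct such points give disjoint rays. -/
theorem exists_rays_of_injOn {V : Type u} {G : SimpleGraph V} {S : Set V} {σ : V → V}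
    (hmaps : MapsTo σ S S) (hinj : InjOn σ S) (hadj : ∀ x ∈ S, σ x = x ∨ G.Adj x (σ x))
    {T : Set V} (hTS : T ⊆ S) (hT : ∀ x ∈ S, σ x ∉ T) :
    ∃ R : T → GraphRay G, (∀ t n, (R t).f n = σ^[n] t) ∧
      ∀ t t', t ≠ t' → Disjoint (range (R t).f) (range (R t').f) := by
  have hS : ∀ (t : T) n, σ^[n] t ∈ S := fun t n => hmaps.iterate n (hTS t.2)
  have key : ∀ (t t' : T) (i d : ℕ), σ^[i] (t : V) = σ^[i + d] (t' : V) → d = 0 ∧ t = t' := by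
    intro t t' i d h
    rw [Function.iterate_add_apply] at h
    have h' := hinj.iterate hmaps i (hTS t.2) (hS t' d) h
    cases d with
    | zero => exact ⟨rfl, Subtype.ext h'⟩
    | succ d =>
      rw [Function.iterate_succ_apply'] at h'
      exact absurd (h' ▸ t.2) (hT _ (hS t' d))
  have key' : ∀ (t t' : T) (i j : ℕ), σ^[i] (t : V) = σ^[j] (t' : V) → i = j ∧ t = t' := by
    intro t t' i j h
    rcases le_total i j with hij | hij
    · obtain ⟨d, rfl⟩ := Nat.exists_eq_add_of_le hij
      obtain ⟨rfl, ht⟩ := key t t' i d h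
      exact ⟨rfl, ht⟩
    · obtain ⟨d, rfl⟩ := Nat.exists_eq_add_of_le hij
      obtain ⟨rfl, ht⟩ := key t' t j d h.symm
      exact ⟨rfl, ht.symm⟩
  refine ⟨fun t => ⟨fun n => σ^[n] t, fun i j h => (key' t t i j h).1, fun n => ?_⟩,
    fun _ _ => rfl, fun t t' hne => ?_⟩
  · rw [Function.iterate_succ_apply']
    refine (hadj _ (hS t n)).resolve_left fun h => ?_
    rw [← Function.iterate_succ_apply' σ n] at h
    have := (key' t t _ _ h).1
    omega
  · rw [Set.disjoint_left]
    rintro _ ⟨i, rfl⟩ ⟨j, h⟩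
    exact hne (key' t' t _ _ h).2.symm

/-- Maps injective on pairwise disjoint sets with pairwise disjoint images glue to an
injective map. -/
theorem exists_glue {α : Type*} {S I : ℕ → Set α} {σ : ℕ → α → α}
    (hS : Pairwise (Function.onFun Disjoint S)) (hI : Pairwise (Function.onFun Disjoint I))
    (hσ : ∀ n, InjOn (σ n) (S n)) (hmaps : ∀ n, MapsTo (σ n) (S n) (I n)) :
    ∃ τ : α → α, (∀ n, ∀ x ∈ S n, τ x = σ n x) ∧ InjOn τ (⋃ n, S n) := by
  classical
  let τ : α → α := fun x => if h : ∃ n, x ∈ S n then σ h.choose x else x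
  have hτ : ∀ n, ∀ x ∈ S n, τ x = σ n x := by
    intro n x hx
    have h : ∃ n, x ∈ S n := ⟨n, hx⟩
    have heq : h.choose = n := by
      by_contra hne
      exact Set.disjoint_left.1 (hS hne) h.choose_spec hx
    simp only [τ, dif_pos h, heq]
  refine ⟨τ, hτ, fun x hx y hy hxy => ?_⟩
  obtain ⟨m, hm⟩ := mem_iUnion.1 hx
  obtain ⟨n, hn⟩ := mem_iUnion.1 hy
  rw [hτ m x hm, hτ n y hn] at hxy
  have hmn : m = n := by
    by_contra hne
    exact Set.disjoint_left.1 (hI hne) (hmaps m hm) (hxy ▸ hmaps n hn)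
  subst hmn
  exact hσ m hm hn hxy

/-- The differences of consecutive terms of a decreasing sequence of sets are disjoint. -/
theorem pairwise_disjoint_of_subset_diff {α : Type*} {S E : ℕ → Set α} (hE : Antitone E)
    (hS : ∀ n, S n ⊆ E n \ E (n + 1)) : Pairwise (Function.onFun Disjoint S) := by
  rw [pairwise_disjoint_on]
  intro m n hmn
  rw [Set.disjoint_left]
  exact fun x hx hx' => (hS m hx).2 (hE hmn (hS n hx').1)

/-- The end has at least as many disjoint rays as any minimum cut has vertices. -/
theorem IsMinCut.degGE {V : Type u} {G : SimpleGraph V} {ω : GraphEnd G} {r : GraphRay G}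
    {D X T : Finset V} (h : IsMinCut G r.f D X T) (hr : r ∈ ω.rays)
    (hD : ∀ v, Dominates G v ω → v ∈ D) (hX : ∀ x ∈ X, x ∉ D) : DegGE G ω T.card := by
  classical
  obtain ⟨X, T, rfl, hT, hXT⟩ := h.exists_seq hr hD hX
  have hT' : ∀ n, IsMinCut G r.f D (X n ∪ T n) (T (n + 1)) := fun n => hXT n ▸ hT (n + 1)
  let C : ℕ → Set V := fun n => tailComp G r.f (↑(T n) ∪ ↑D)
  choose W σ hTW hTW' hW hinj hσ using fun n => (hT n).exists_linkage (hT' n) hr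
  have hCanti : Antitone C := antitone_nat_of_succ_le fun n => (hT' n).tailComp_subset hr
  have hTC : ∀ n, (T (n + 1) : Set V) ⊆ C n := fun n => (hT' n).subset_tailComp hr
  have hTnC : ∀ n, ∀ x ∈ T n, x ∉ C n := fun n x hx hxC => notMem_of_mem_tailComp hxC (.inl hx)
  let E : ℕ → Set V := fun n => C n ∪ T n
  have hEC : ∀ n, E (n + 1) ⊆ C n := fun n => union_subset (hCanti (Nat.le_succ n)) (hTC n)
  have hEanti : Antitone E := antitone_nat_of_succ_le fun n => (hEC n).trans subset_union_left
  have hTdisj : Pairwise (Function.onFun Disjoint fun n => (T n : Set V)) :=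
    pairwise_disjoint_of_subset_diff hEanti fun n x hx =>
      ⟨.inr hx, fun hxE => hTnC n x hx (hEC n hxE)⟩
  let S : ℕ → Set V := fun n => ↑(W n \ T (n + 1))
  have hSE : ∀ n, S n ⊆ E n \ E (n + 1) := by
    intro n x hx
    obtain ⟨hxW, hxT⟩ := Finset.mem_sdiff.1 hx
    exact ⟨(hW n x hxW).1, fun hxE => hxE.elim (hW n x hxW).2 hxT⟩
  have hIC : ∀ n, (↑(W n \ T n) : Set V) ⊆ C n \ C (n + 1) := by
    intro n x hx
    obtain ⟨hxW, hxT⟩ := Finset.mem_sdiff.1 hx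
    exact ⟨(hW n x hxW).1.resolve_right hxT, (hW n x hxW).2⟩
  obtain ⟨τ, hτ, hτinj⟩ := exists_glue (pairwise_disjoint_of_subset_diff hEanti hSE)
    (pairwise_disjoint_of_subset_diff hCanti hIC) hinj fun n x hx => (hσ n x hx).1
  have hTS : ∀ n, (T n : Set V) ⊆ S n := fun n x hx => Finset.mem_coe.2 (Finset.mem_sdiff.2
    ⟨hTW n hx, Set.disjoint_left.1 (hTdisj (Nat.ne_of_lt n.lt_succ_self)) hx⟩)
  have hτI : ∀ n, ∀ x ∈ S n, τ x ∈ W n \ T n := fun n x hx => hτ n x hx ▸ (hσ n x hx).1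
  have hmaps : MapsTo τ (⋃ n, S n) (⋃ n, S n) := by
    intro x hx
    obtain ⟨n, hn⟩ := mem_iUnion.1 hx
    have hW' := (Finset.mem_sdiff.1 (hτI n x hn)).1
    by_cases hτT : τ x ∈ T (n + 1)
    · exact mem_iUnion.2 ⟨n + 1, hTS _ hτT⟩
    · exact mem_iUnion.2 ⟨n, Finset.mem_coe.2 (Finset.mem_sdiff.2 ⟨hW', hτT⟩)⟩
  obtain ⟨R, hR, hRdisj⟩ := exists_rays_of_injOn (G := G) (T := T 0) hmaps hτinj (by
      intro x hx
      obtain ⟨n, hn⟩ := mem_iUnion.1 hx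
      rw [hτ n x hn]
      exact (hσ n x hn).2)
    ((hTS 0).trans (subset_iUnion S 0)) (by
      intro x hx hxT
      obtain ⟨n, hn⟩ := mem_iUnion.1 hx
      exact hTnC 0 _ hxT (hCanti n.zero_le (hIC n (hτI n x hn)).1))
  have hRS : ∀ t n, (R t).f n ∈ ⋃ n, S n := by
    intro t n
    rw [hR]
    exact hmaps.iterate n (mem_iUnion.2 ⟨0, hTS 0 t.2⟩)
  have hempty : ∀ t : (T 0 : Set V), ∀ x, ∃ n, x ∉ C n := by
    intro t x
    by_contra! hx
    have hp := hIC 0 (hτI 0 t (hTS 0 t.2))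
    obtain ⟨w, hw⟩ := conn_of_mem_tailComp (hx 0) hp.1
    have hmeet : ∀ n, ∃ y ∈ w.support, y ∈ T (n + 1) := by
      intro n
      by_contra! hn
      refine hp.2 (hCanti (Nat.le_add_left 1 n) ?_)
      refine tailComp_of_conn (hx (n + 1)) (AvoidConn.symm ⟨w, fun y hy => ?_⟩)
      rintro (hyT | hyD)
      exacts [hn y hy hyT, hw y hy (.inr hyD)]
    choose y hyw hyT using hmeet
    refine Set.infinite_range_of_injective (f := y) (fun i j hij => ?_)
      (w.support.finite_toSet.subset (range_subset_iff.2 hyw))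
    by_contra hne
    refine Set.disjoint_left.1 (hTdisj (i := i + 1) (j := j + 1) (by omega)) (hyT i) ?_
    exact hij ▸ hyT j
  have hRω : ∀ t, R t ∈ ω.rays := by
    intro t
    rw [ω.mem_iff r hr]
    intro F hF
    choose ν hν using hempty t
    obtain ⟨N, hN⟩ := (hF.image ν).bddAbove
    have hFN : ∀ x ∈ F, x ∉ C N := fun x hx hxC =>
      hν x (hCanti (hN (mem_image_of_mem ν hx)) hxC)
    obtain ⟨i, hi⟩ := (R t).eventually_notMem
      ((finite_Iic N).biUnion fun n _ => (W n \ T (n + 1)).finite_toSet)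
    have hiC : (R t).f i ∈ C N := by
      obtain ⟨n, hn⟩ := mem_iUnion.1 (hRS t i)
      have hNn : N < n := by
        by_contra! hle
        exact hi i le_rfl (mem_biUnion (mem_Iic.2 hle) hn)
      exact hEC N (hEanti hNn (hSE n hn).1)
    obtain ⟨M, hM⟩ := ray_mem_tailComp hr (T N) D
    obtain ⟨w, hw⟩ := conn_compl_tailComp (hM M le_rfl) hiC
    exact ⟨M, i, w, fun x hx hxF => hw x hx (hFN x hxF)⟩
  let e := (T 0).equivFin.symm
  exact ⟨fun i => R (e i), fun i => hRω _, fun i j hij => hRdisj _ _ (e.injective.ne hij)⟩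

theorem DegGE.mono {V : Type u} {G : SimpleGraph V} {ω : GraphEnd G} {m n : ℕ} (hmn : m ≤ n)
    (h : DegGE G ω n) : DegGE G ω m := by
  obtain ⟨R, hR, hd⟩ := h
  exact ⟨fun i => R (Fin.castLE hmn i), fun i => hR _,
    fun i j hij => hd _ _ ((Fin.castLE_injective hmn).ne hij)⟩

theorem DomGE.mono {V : Type u} {G : SimpleGraph V} {ω : GraphEnd G} {m n : ℕ} (hmn : m ≤ n)
    (h : DomGE G ω n) : DomGE G ω m := by
  obtain ⟨D, rfl, hD⟩ := h
  obtain ⟨D', hsub, hcard⟩ := Finset.exists_subset_card_eq hmn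
  exact ⟨D', hcard, fun v hv => hD v (hsub hv)⟩

theorem degGE_zero {V : Type u} (G : SimpleGraph V) (ω : GraphEnd G) : DegGE G ω 0 :=
  ⟨fun i => i.elim0, fun i => i.elim0, fun i => i.elim0⟩

theorem finite_dominating {V : Type u} {G : SimpleGraph V} {ω : GraphEnd G} {k : ℕ}
    (h : ¬ DegDomGE G ω k) :
    {v | Dominates G v ω}.Finite ∧ {v | Dominates G v ω}.ncard < k := by
  have hfin : {v | Dominates G v ω}.Finite := by
    by_contra hinf
    obtain ⟨D, hD, hcard⟩ := Set.Infinite.exists_subset_card_eq hinf k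
    exact h ⟨0, k, by omega, degGE_zero G ω, D, hcard, fun v hv => hD hv⟩
  refine ⟨hfin, ?_⟩
  by_contra! hle
  refine h ⟨0, k, by omega, degGE_zero G ω, DomGE.mono hle ⟨hfin.toFinset, ?_, ?_⟩⟩
  · exact (ncard_eq_toFinset_card _ hfin).symm
  · exact fun v hv => by simpa using hv

/-- An open set around `s` contains all separations agreeing with `s` on some finite set. -/
theorem exists_finite_of_isOpen {V : Type u} {G : SimpleGraph V} {O : Set (FinSep G)}
    (hO : IsOpen O) {s : FinSep G} (hs : s ∈ O) :
    ∃ Z : Set V, Z.Finite ∧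
      ∀ t : FinSep G, t.1.A ∩ Z = s.1.A ∩ Z → t.1.B ∩ Z = s.1.B ∩ Z → t ∈ O := by
  induction hO with
  | basic O h =>
    obtain ⟨Z, AZ, BZ, hZ, rfl⟩ := h
    exact ⟨Z, hZ, fun t hA hB => ⟨hA.trans hs.1, hB.trans hs.2⟩⟩
  | univ => exact ⟨∅, finite_empty, fun t _ _ => mem_univ t⟩
  | inter O O' _ _ ih ih' =>
    obtain ⟨Z, hZ, h⟩ := ih hs.1
    obtain ⟨Z', hZ', h'⟩ := ih' hs.2
    have restrict : ∀ {P Q U U' : Set V}, P ∩ U = Q ∩ U → U' ⊆ U → P ∩ U' = Q ∩ U' := by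
      intro P Q U U' hPQ hU
      rw [← inter_eq_right.2 hU, ← inter_assoc, ← inter_assoc, hPQ]
    exact ⟨Z ∪ Z', hZ.union hZ', fun t hA hB =>
      ⟨h t (restrict hA subset_union_left) (restrict hB subset_union_left),
        h' t (restrict hA subset_union_right) (restrict hB subset_union_right)⟩⟩
  | sUnion 𝒪 _ ih =>
    obtain ⟨O, hO, hsO⟩ := hs
    obtain ⟨Z, hZ, h⟩ := ih O hO hsO
    exact ⟨Z, hZ, fun t hA hB => ⟨O, hO, h t hA hB⟩⟩

/-- The separation of `G` with separator `T ∪ D` given by a cut. -/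
def IsCut.finSep {V : Type u} (G : SimpleGraph V) (r : ℕ → V) (D T : Finset V) : FinSep G :=
  ⟨⟨(tailComp G r (↑T ∪ ↑D))ᶜ, tailComp G r (↑T ∪ ↑D) ∪ (↑T ∪ ↑D), by
      rw [← union_assoc, compl_union_self, univ_union],
    fun a ha b hb hadj => ha.2 (.inl (tailComp_of_adj (not_not.1 hb.2) hadj
      fun h => ha.2 (.inr h)))⟩,
    (T.finite_toSet.union D.finite_toSet).subset fun _ hx => hx.2.resolve_left hx.1⟩

theorem exists_endTangle_agree {V : Type u} {G : SimpleGraph V} {ω : GraphEnd G} {k : ℕ}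
    (h : ¬ DegDomGE G ω k) {Z : Set V} (hZ : Z.Finite) :
    ∃ t ∈ endTangle ω, (t.1.A ∩ t.1.B).ncard < k ∧
      t.1.A ∩ Z = Z ∧ t.1.B ∩ Z = {v | Dominates G v ω} ∩ Z := by
  classical
  obtain ⟨r, hr⟩ := ω.nonempty
  obtain ⟨hfin, hcard⟩ := finite_dominating h
  set D := hfin.toFinset with hDdef
  have hD : ∀ v, v ∈ D ↔ Dominates G v ω := fun v => by simp [D]
  rw [ncard_eq_toFinset_card _ hfin, ← hDdef] at hcard
  obtain ⟨T, hT⟩ := exists_isMinCut (X := hZ.toFinset \ D) hr (fun v => (hD v).2)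
    fun x hx => (Finset.mem_sdiff.1 hx).2
  have hlt : T.card + D.card < k := by
    by_contra! hle
    refine h ⟨k - D.card, D.card, by omega, DegGE.mono (by omega) (hT.degGE hr
      (fun v => (hD v).2) fun x hx => (Finset.mem_sdiff.1 hx).2), D, rfl, fun v => (hD v).1⟩
  have hZX : ∀ x ∈ Z, x ∉ D → x ∈ hZ.toFinset \ D := fun x hx hxD => by simp [hx, hxD]
  have hZC : ∀ x ∈ Z, x ∉ tailComp G r.f (↑T ∪ ↑D) := by
    intro x hx hxC
    by_cases hxD : x ∈ D
    · exact notMem_of_mem_tailComp hxC (.inr hxD)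
    · exact hT.sep x (hZX x hx hxD) hxC
  refine ⟨IsCut.finSep G r.f D T, fun R hR => ?_, ?_, inter_eq_right.2 hZC, ?_⟩
  · obtain ⟨N, hN⟩ := GraphEnd.hasTailIn_tailComp hr hR (T.finite_toSet.union D.finite_toSet)
    exact ⟨N, fun n hn => .inl (hN n hn)⟩
  · refine ((ncard_le_ncard (t := ↑(T ∪ D)) (fun x hx => ?_) (Finset.finite_toSet _)).trans
      ?_).trans_lt hlt
    · rw [Finset.coe_union]
      exact hx.2.resolve_left hx.1
    · rw [ncard_coe_finset]
      exact Finset.card_union_le _ _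
  · ext x
    refine and_congr_left fun hx => ⟨?_, fun hxD => .inr (.inr ((hD x).2 hxD))⟩
    rintro (hxC | hxT | hxD)
    · exact absurd hxC (hZC x hx)
    · by_contra hxD
      exact hT.notMem_X x hxT (hZX x hx fun h => hxD ((hD x).1 h))
    · exact (hD x).1 hxD

/-- if `deg(ω) + dom(ω) < k` then `τ_ω ∩ S⃗_k` is not closed:
`(V, D)` (with `D` the dominating vertices) lies in `S⃗_k ∖ τ_ω` but agrees on
every finite `Z` with some member of `τ_ω ∩ S⃗_k`. -/
theorem small_deg_dom_not_closed {V : Type u} (G : SimpleGraph V) (ω : GraphEnd G)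
    (k : ℕ) (h : ¬ DegDomGE G ω k) :
    ¬ IsClosed {s : FinSep G | s ∈ endTangle ω ∧ (s.1.A ∩ s.1.B).ncard < k} ∧
    ∀ s : FinSep G, s.1.A = Set.univ → s.1.B = {v : V | Dominates G v ω} →
      (s.1.A ∩ s.1.B).ncard < k ∧ s ∉ endTangle ω ∧
      ∀ Z : Set V, Z.Finite → ∃ t ∈ endTangle ω, (t.1.A ∩ t.1.B).ncard < k ∧
        t.1.A ∩ Z = s.1.A ∩ Z ∧ t.1.B ∩ Z = s.1.B ∩ Z := by
  obtain ⟨hfin, hcard⟩ := finite_dominating h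
  have main : ∀ s : FinSep G, s.1.A = Set.univ → s.1.B = {v : V | Dominates G v ω} →
      (s.1.A ∩ s.1.B).ncard < k ∧ s ∉ endTangle ω ∧
      ∀ Z : Set V, Z.Finite → ∃ t ∈ endTangle ω, (t.1.A ∩ t.1.B).ncard < k ∧
        t.1.A ∩ Z = s.1.A ∩ Z ∧ t.1.B ∩ Z = s.1.B ∩ Z := by
    intro s hA hB
    rw [hA, hB, univ_inter]
    refine ⟨hcard, fun hs => ?_, fun Z hZ => ?_⟩
    · obtain ⟨R, hR⟩ := ω.nonempty
      obtain ⟨N, hN⟩ := hs R hR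
      obtain ⟨M, hM⟩ := R.eventually_notMem hfin
      exact hM (max N M) (le_max_right _ _) (hB ▸ hN (max N M) (le_max_left _ _))
    · rw [univ_inter]
      exact exists_endTangle_agree h hZ
  refine ⟨fun hclosed => ?_, main⟩
  let s : FinSep G := ⟨⟨univ, {v | Dominates G v ω}, univ_union _,
    fun a _ b hb => absurd (mem_univ b) hb.2⟩, hfin.subset inter_subset_right⟩
  obtain ⟨-, hs, hagree⟩ := main s rfl rfl
  obtain ⟨Z, hZ, hO⟩ := exists_finite_of_isOpen hclosed.isOpen_compl (s := s) fun h => hs h.1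
  obtain ⟨t, ht, htk, hA, hB⟩ := hagree Z hZ
  exact hO t hA hB ⟨ht, htk⟩
end

section
/- An end ω of a graph G has infinite cohesion (its end tangle τ_ω is closed in S⃗) if and only if ω is dominated by infinitely many vertices; moreover, ω has bounded cohesion coh(ω) = k ∈ ℕ if and only if deg(ω) + dom(ω) = k − 1. -/
open Set

universe u

section CohesionLemmas

variable {V : Type u} {G : SimpleGraph V} {ω : GraphEnd G}

/-- A set of finite-order separations is closed iff it contains every separation that it
approximates on all finite vertex sets. -/
theorem isClosed_finSep_iff {T : Set (FinSep G)} :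
    IsClosed T ↔ ∀ s : FinSep G, (∀ Z : Set V, Z.Finite →
      ∃ t ∈ T, t.1.A ∩ Z = s.1.A ∩ Z ∧ t.1.B ∩ Z = s.1.B ∩ Z) → s ∈ T := by
  constructor
  · intro hT s hs
    by_contra hsT
    have key : ∀ O : Set (FinSep G), IsOpen O → s ∈ O → ∃ Z : Set V, Z.Finite ∧
        ∀ t : FinSep G, t.1.A ∩ Z = s.1.A ∩ Z → t.1.B ∩ Z = s.1.B ∩ Z → t ∈ O := by
      intro O hO
      induction hO with
      | basic O hO =>
        obtain ⟨Z, AZ, BZ, hZ, rfl⟩ := hO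
        intro hsO
        exact ⟨Z, hZ, fun t h1 h2 => ⟨h1.trans hsO.1, h2.trans hsO.2⟩⟩
      | univ => exact fun _ => ⟨∅, finite_empty, fun _ _ _ => mem_univ _⟩
      | inter O₁ O₂ _ _ ih₁ ih₂ =>
        intro hsO
        obtain ⟨Z₁, hZ₁, h₁⟩ := ih₁ hsO.1
        obtain ⟨Z₂, hZ₂, h₂⟩ := ih₂ hsO.2
        have restrict : ∀ {X Y Z Z' : Set V}, Z' ⊆ Z → X ∩ Z = Y ∩ Z → X ∩ Z' = Y ∩ Z' := by
          intro X Y Z Z' hZ' h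
          rw [← inter_eq_self_of_subset_right hZ', ← inter_assoc, h, inter_assoc]
        exact ⟨Z₁ ∪ Z₂, hZ₁.union hZ₂, fun t hA hB =>
          ⟨h₁ t (restrict subset_union_left hA) (restrict subset_union_left hB),
           h₂ t (restrict subset_union_right hA) (restrict subset_union_right hB)⟩⟩
      | sUnion C _ ih =>
        rintro ⟨O, hOC, hsO⟩
        obtain ⟨Z, hZ, h⟩ := ih O hOC hsO
        exact ⟨Z, hZ, fun t h1 h2 => ⟨O, hOC, h t h1 h2⟩⟩
    obtain ⟨Z, hZ, h⟩ := key Tᶜ hT.isOpen_compl hsT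
    obtain ⟨t, ht, hA, hB⟩ := hs Z hZ
    exact h t hA hB ht
  · intro h
    rw [← isOpen_compl_iff, isOpen_iff_forall_mem_open]
    intro s hs
    have : ¬ ∀ Z : Set V, Z.Finite →
        ∃ t ∈ T, t.1.A ∩ Z = s.1.A ∩ Z ∧ t.1.B ∩ Z = s.1.B ∩ Z := fun h' => hs (h s h')
    push Not at this
    obtain ⟨Z, hZ, hT⟩ := this
    exact ⟨{t | t.1.A ∩ Z = s.1.A ∩ Z ∧ t.1.B ∩ Z = s.1.B ∩ Z},
      fun t ht htT => hT t htT ht.1 ht.2,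
      TopologicalSpace.GenerateOpen.basic _ ⟨Z, _, _, hZ, rfl⟩, rfl, rfl⟩

theorem Separation.mem_or (s : Separation G) (v : V) : v ∈ s.A ∨ v ∈ s.B :=
  (mem_union _ _ _).1 (s.union_eq ▸ mem_univ v)

theorem Separation.mem_A_of_adj (s : Separation G) {a b : V} (ha : a ∉ s.B) (h : G.Adj a b) :
    b ∈ s.A := by
  by_contra hb
  exact s.no_edge a ⟨(s.mem_or a).resolve_right ha, ha⟩ b ⟨(s.mem_or b).resolve_left hb, hb⟩ h

theorem Separation.mem_B_of_adj (s : Separation G) {a b : V} (ha : a ∉ s.A) (h : G.Adj a b) :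
    b ∈ s.B := by
  by_contra hb
  exact s.no_edge b ⟨(s.mem_or b).resolve_right hb, hb⟩ a ⟨(s.mem_or a).resolve_left ha, ha⟩ h.symm

theorem Separation.notMem_A_of_walk (s : Separation G) {a b : V} (w : G.Walk a b)
    (hw : ∀ x ∈ w.support, x ∉ s.A ∩ s.B) (ha : a ∉ s.A) : b ∉ s.A := by
  induction w with
  | nil => exact ha
  | cons h p ih =>
    refine ih (fun x hx => hw x (by simp [hx])) fun hc => ?_
    exact hw _ (by simp) ⟨hc, s.mem_B_of_adj ha h⟩

theorem Separation.notMem_B_of_walk (s : Separation G) {a b : V} (w : G.Walk a b)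
    (hw : ∀ x ∈ w.support, x ∉ s.A ∩ s.B) (ha : a ∉ s.B) : b ∉ s.B := by
  induction w with
  | nil => exact ha
  | cons h p ih =>
    refine ih (fun x hx => hw x (by simp [hx])) fun hc => ?_
    exact hw _ (by simp) ⟨s.mem_A_of_adj ha h, hc⟩

theorem GraphRay.exists_forall_notMem (R : GraphRay G) {F : Set V} (hF : F.Finite) :
    ∃ N, ∀ n ≥ N, R.f n ∉ F := by
  obtain ⟨N, hN⟩ := (hF.preimage R.inj.injOn).bddAbove
  refine ⟨N + 1, fun n hn h => ?_⟩
  have := hN (show n ∈ R.f ⁻¹' F from h)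
  omega

/-- Every ray has a tail strictly on one side of a given finite-order separation. -/
theorem GraphRay.tail_dichotomy (R : GraphRay G) (s : FinSep G) :
    ∃ N, (∀ n ≥ N, R.f n ∉ s.1.A) ∨ (∀ n ≥ N, R.f n ∉ s.1.B) := by
  obtain ⟨N, hN⟩ := R.exists_forall_notMem s.2
  refine ⟨N, ?_⟩
  by_cases hA : R.f N ∈ s.1.A
  · right
    intro n hn
    induction n, hn using Nat.le_induction with
    | base => exact fun hB => hN N le_rfl ⟨hA, hB⟩
    | succ n hn ih =>
      exact fun hB => hN (n + 1) (by omega) ⟨s.1.mem_A_of_adj ih (R.adj n), hB⟩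
  · left
    intro n hn
    induction n, hn using Nat.le_induction with
    | base => exact hA
    | succ n hn ih =>
      exact fun hA' => hN (n + 1) (by omega) ⟨hA', s.1.mem_B_of_adj ih (R.adj n)⟩

/-- A separation lies in the end tangle as soon as one ray of the end has a tail in its
second side. -/
theorem mem_endTangle_of_hasTailIn {R : GraphRay G} (hR : R ∈ ω.rays) {s : FinSep G}
    (h : HasTailIn R s.1.B) : s ∈ endTangle ω := by
  intro R' hR'
  obtain ⟨N', hN' | hN'⟩ := R'.tail_dichotomy s
  · exact ⟨N', fun n hn => (s.1.mem_or _).resolve_left (hN' n hn)⟩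
  obtain ⟨M, hM⟩ := h
  obtain ⟨N, hN | hN⟩ := R.tail_dichotomy s
  · obtain ⟨m, n, w, hw⟩ := (ω.mem_iff R hR R').1 hR'
      (s.1.A ∩ s.1.B ∪ (R.f '' Iio N ∪ R'.f '' Iio N'))
      (s.2.union (((finite_Iio N).image _).union ((finite_Iio N').image _)))
    have hm : N ≤ m := by
      by_contra hlt
      exact hw _ w.start_mem_support (Or.inr (Or.inl ⟨m, by simpa using hlt, rfl⟩))
    have hn : N' ≤ n := by
      by_contra hlt
      exact hw _ w.end_mem_support (Or.inr (Or.inr ⟨n, by simpa using hlt, rfl⟩))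
    have hnA := s.1.notMem_A_of_walk w (fun x hx hx' => hw x hx (Or.inl hx')) (hN m hm)
    exact absurd (s.1.mem_or (R'.f n)) (not_or.2 ⟨hnA, hN' n hn⟩)
  · exact absurd (hM (max M N) (le_max_left _ _)) (hN _ (le_max_right _ _))

theorem rev_mem_endTangle {s : FinSep G} (h : s ∉ endTangle ω) : s.rev ∈ endTangle ω := by
  obtain ⟨R, hR⟩ := ω.nonempty
  obtain ⟨N, hN | hN⟩ := R.tail_dichotomy s
  · exact absurd (mem_endTangle_of_hasTailIn hR
      ⟨N, fun n hn => (s.1.mem_or _).resolve_left (hN n hn)⟩) h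
  · exact mem_endTangle_of_hasTailIn hR
      ⟨N, fun n hn => (s.1.mem_or _).resolve_right (hN n hn)⟩

/-- A dominating vertex lies on the side of every separation towards which the end orients it. -/
theorem Dominates.mem_B {v : V} (hv : Dominates G v ω) {s : FinSep G} (hs : s ∈ endTangle ω) :
    v ∈ s.1.B := by
  by_contra hvB
  obtain ⟨R, hR, p, -, hinj, hdisj⟩ := hv
  obtain ⟨N, hN⟩ := hs R hR
  have hex : ∀ i, ∃ x, N ≤ (p i).1 → x ∈ (p i).2.support ∧ x ∈ s.1.A ∩ s.1.B := by
    intro i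
    by_cases hi : N ≤ (p i).1
    · by_contra hcon
      push Not at hcon
      exact s.1.notMem_B_of_walk (p i).2 (fun x hx => (hcon x).2 hx) hvB (hN _ hi)
    · exact ⟨v, fun h => absurd h hi⟩
  choose c hc using hex
  have hfin : {i | ¬ N ≤ (p i).1}.Finite := by
    refine ((finite_Iio N).preimage hinj.injOn).subset fun i hi => ?_
    simpa using hi
  have hinf : {i | N ≤ (p i).1}.Infinite := by
    have := hfin.infinite_compl
    simpa [compl_ofPred] using this
  refine infinite_of_injOn_mapsTo (f := c) (t := s.1.A ∩ s.1.B) ?_ (fun i hi => (hc i hi).2) hinf s.2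
  intro i hi j hj hij
  by_contra hne
  have := hdisj i j hne (c i) (hc i hi).1 (hij ▸ (hc j hj).1)
  exact hvB (this ▸ (hc i hi).2.2)

/-- Shrink the second side of a separation to the vertices of `D` and those which can reach `Q`
inside it without using `D`. -/
def FinSep.toward (s : FinSep G) (D Q : Set V) (hA : D ⊆ s.1.A) (hB : D ⊆ s.1.B) : FinSep G :=
  ⟨{ A := s.1.A ∪ (D ∪ {v | ∃ t ∈ Q, ∃ w : G.Walk v t, ∀ x ∈ w.support, x ∈ s.1.B \ D})ᶜ
     B := D ∪ {v | ∃ t ∈ Q, ∃ w : G.Walk v t, ∀ x ∈ w.support, x ∈ s.1.B \ D}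
     union_eq := by rw [union_assoc, compl_union_self, union_univ]
     no_edge := by
      rintro a ⟨-, ha⟩ b ⟨hb | ⟨t, ht, w, hw⟩, hbA⟩ hab
      · exact hbA (Or.inl (hA hb))
      · have hbA' : b ∉ s.1.A := fun h => hbA (Or.inl h)
        have haB := s.1.mem_B_of_adj hbA' hab.symm
        refine ha (Or.inr ⟨t, ht, w.cons hab, fun x hx => ?_⟩)
        rw [SimpleGraph.Walk.support_cons, List.mem_cons] at hx
        rcases hx with rfl | hx
        · exact ⟨haB, fun h => ha (Or.inl h)⟩
        · exact hw x hx },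
   s.2.subset (by
    rintro x ⟨hxA | hxA, hxB⟩
    · refine ⟨hxA, ?_⟩
      rcases hxB with hxD | ⟨t, ht, w, hw⟩
      · exact hB hxD
      · exact (hw _ w.start_mem_support).1
    · exact absurd hxB hxA)⟩

theorem FinSep.toward_B_subset (s : FinSep G) {D Q : Set V} (hA : D ⊆ s.1.A) (hB : D ⊆ s.1.B) :
    (s.toward D Q hA hB).1.B ⊆ s.1.B := by
  rintro x (hxD | ⟨t, ht, w, hw⟩)
  · exact hB hxD
  · exact (hw _ w.start_mem_support).1

theorem FinSep.toward_separator_subset (s : FinSep G) {D Q : Set V} (hA : D ⊆ s.1.A)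
    (hB : D ⊆ s.1.B) :
    (s.toward D Q hA hB).1.A ∩ (s.toward D Q hA hB).1.B ⊆ s.1.A ∩ s.1.B := by
  rintro x ⟨hxA | hxA, hxB⟩
  · exact ⟨hxA, s.toward_B_subset hA hB hxB⟩
  · exact absurd hxB hxA

theorem FinSep.toward_mem_endTangle (s : FinSep G) (hs : s ∈ endTangle ω) {D : Set V}
    (hD : D.Finite) {R : GraphRay G} (hR : R ∈ ω.rays) (hA : D ⊆ s.1.A) (hB : D ⊆ s.1.B)
    {Q : Set V} (hQ : HasTailIn R Q) :
    s.toward D Q hA hB ∈ endTangle ω := by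
  obtain ⟨N, hN⟩ := R.exists_forall_notMem hD
  obtain ⟨M, hM⟩ := hs R hR
  obtain ⟨K, hK⟩ := hQ
  refine mem_endTangle_of_hasTailIn hR ⟨max K (max N M), fun n hn => Or.inr
    ⟨R.f n, hK n (by omega), SimpleGraph.Walk.nil, fun x hx => ?_⟩⟩
  obtain rfl : x = R.f n := by simpa using hx
  exact ⟨hM n (by omega), hN n (by omega)⟩

/-- The separation `(F, V)`. -/
def FinSep.ofFinite (G : SimpleGraph V) {F : Set V} (hF : F.Finite) : FinSep G :=
  ⟨{ A := F, B := univ, union_eq := union_univ _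
     no_edge := fun a ha => absurd (mem_univ a) ha.2 }, hF.subset inter_subset_left⟩

theorem FinSep.ofFinite_mem_endTangle {F : Set V} (hF : F.Finite) :
    FinSep.ofFinite G hF ∈ endTangle ω :=
  fun _ _ => ⟨0, fun _ _ => mem_univ _⟩

/-- A vertex which no separation of the end tangle separates from the end dominates the end. -/
theorem dominates_of_forall_mem_B {v : V} (h : ∀ s ∈ endTangle ω, v ∈ s.1.B) :
    Dominates G v ω := by
  classical
  obtain ⟨R, hR⟩ := ω.nonempty
  have hQ : HasTailIn R (range R.f \ {v}) := by
    obtain ⟨N, hN⟩ := R.exists_forall_notMem (finite_singleton v)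
    exact ⟨N, fun n hn => ⟨mem_range_self n, hN n hn⟩⟩
  have hwalk : ∀ F : Set V, F.Finite → v ∉ F → ∃ n, R.f n ≠ v ∧
      ∃ w : G.Walk v (R.f n), ∀ x ∈ w.support, x ∉ F := by
    intro F hF hvF
    have hmem := h _ ((FinSep.ofFinite G hF).toward_mem_endTangle
      (FinSep.ofFinite_mem_endTangle hF) hF hR subset_rfl (subset_univ _) hQ)
    rcases hmem with hvF' | ⟨_, ⟨⟨n, rfl⟩, hn⟩, w, hw⟩
    · exact absurd hvF' hvF
    · exact ⟨n, hn, w, fun x hx => (hw x hx).2⟩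
  obtain ⟨p, hp, hdisj⟩ := exists_seq_of_forall_finset_exists
    (fun q : (n : ℕ) × G.Walk v (R.f n) => q.2.IsPath ∧ R.f q.1 ≠ v)
    (fun q q' => ∀ x, x ∈ q.2.support → x ∈ q'.2.support → x = v) (by
      intro S _
      obtain ⟨n, hn, w, hw⟩ := hwalk ((⋃ q ∈ S, {x | x ∈ q.2.support}) \ {v})
        ((S.finite_toSet.biUnion fun q _ => q.2.support.finite_toSet).sdiff) (by simp)
      refine ⟨⟨n, w.bypass⟩, ⟨w.bypass_isPath, hn⟩, fun q hq x hx hx' => ?_⟩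
      by_contra hxv
      exact hw x (w.support_bypass_subset_support hx') ⟨mem_biUnion hq hx, hxv⟩)
  have hdisj' : ∀ i j, i ≠ j → ∀ x, x ∈ (p i).2.support → x ∈ (p j).2.support → x = v := by
    intro i j hij x hi hj
    rcases lt_or_gt_of_ne hij with h | h
    · exact hdisj i j h x hi hj
    · exact hdisj j i h x hj hi
  refine ⟨R, hR, p, fun i => (hp i).1, fun i j hij => ?_, hdisj'⟩
  by_contra hne
  have hij' : (p i).1 = (p j).1 := hij
  refine (hp i).2 (hdisj' i j hne _ (p i).2.end_mem_support ?_)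
  rw [hij']
  exact (p j).2.end_mem_support

/-- The separation `(A ∪ A', B ∩ B')`. -/
def FinSep.inf (s t : FinSep G) : FinSep G :=
  ⟨{ A := s.1.A ∪ t.1.A, B := s.1.B ∩ t.1.B
     union_eq := by
      ext v
      have hs := s.1.mem_or v
      have ht := t.1.mem_or v
      simp only [mem_union, mem_inter_iff, mem_univ, iff_true]
      tauto
     no_edge := by
      rintro a ⟨-, ha⟩ b ⟨-, hb⟩ hab
      by_cases has : a ∈ s.1.B
      · exact hb (Or.inr (t.1.mem_A_of_adj (fun h => ha ⟨has, h⟩) hab))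
      · exact hb (Or.inl (s.1.mem_A_of_adj has hab)) },
   (s.2.union t.2).subset (by
    rintro x ⟨hx | hx, hx'⟩
    · exact Or.inl ⟨hx, hx'.1⟩
    · exact Or.inr ⟨hx, hx'.2⟩)⟩

/-- The separation `(A ∪ D, B ∪ D)`. -/
def FinSep.adjoin (s : FinSep G) {D : Set V} (hD : D.Finite) : FinSep G :=
  ⟨{ A := s.1.A ∪ D, B := s.1.B ∪ D
     union_eq := by
      rw [← union_union_distrib_right, s.1.union_eq, univ_union]
     no_edge := by
      rintro a ⟨-, ha⟩ b ⟨-, hb⟩ hab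
      exact hb (Or.inl (s.1.mem_A_of_adj (fun h => ha (Or.inl h)) hab)) },
   (s.2.union hD).subset (by rw [inter_union_distrib_right])⟩

/-- The separation `s` lies in the end tangle of `ω` and its separator contains `D`. -/
structure SeparatesOver (ω : GraphEnd G) (D : Set V) (s : FinSep G) : Prop where
  mem : s ∈ endTangle ω
  subset_A : D ⊆ s.1.A
  subset_B : D ⊆ s.1.B

theorem SeparatesOver.inf {D : Set V} {s t : FinSep G} (hs : SeparatesOver ω D s)
    (ht : SeparatesOver ω D t) : SeparatesOver ω D (s.inf t) where
  mem := by
    intro R hR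
    obtain ⟨N, hN⟩ := hs.mem R hR
    obtain ⟨M, hM⟩ := ht.mem R hR
    exact ⟨max N M, fun n hn => ⟨hN n (by omega), hM n (by omega)⟩⟩
  subset_A := fun _ hx => Or.inl (hs.subset_A hx)
  subset_B := fun _ hx => ⟨hs.subset_B hx, ht.subset_B hx⟩

/-- If `D` is finite and contains all dominating vertices, then every finite set can be separated
from the end outside `D`. -/
theorem exists_separatesOver {D : Set V} (hD : D.Finite) (hdom : ∀ v, Dominates G v ω → v ∈ D)
    {Z : Set V} (hZ : Z.Finite) : ∃ s : FinSep G, SeparatesOver ω D s ∧ s.1.B ∩ Z ⊆ D := by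
  induction Z, hZ using Set.Finite.induction_on with
  | empty =>
    exact ⟨FinSep.ofFinite G hD, ⟨FinSep.ofFinite_mem_endTangle hD, subset_rfl, subset_univ _⟩,
      by simp⟩
  | @insert z Z _ _ ih =>
    obtain ⟨s, hs, hsZ⟩ := ih
    by_cases hz : z ∈ D
    · refine ⟨s, hs, ?_⟩
      rintro x ⟨hxB, rfl | hxZ⟩
      · exact hz
      · exact hsZ ⟨hxB, hxZ⟩
    have : ∃ t ∈ endTangle ω, z ∉ t.1.B := by
      by_contra hcon
      push Not at hcon
      exact hz (hdom z (dominates_of_forall_mem_B hcon))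
    obtain ⟨t, ht, hzt⟩ := this
    have hov : SeparatesOver ω D (t.adjoin hD) :=
      ⟨fun R hR => (ht R hR).imp fun N hN n hn => Or.inl (hN n hn),
        subset_union_right, subset_union_right⟩
    refine ⟨s.inf (t.adjoin hD), hs.inf hov, ?_⟩
    rintro x ⟨⟨hxs, hxt⟩, rfl | hxZ⟩
    · exact hxt.resolve_left hzt
    · exact hsZ ⟨hxs, hxZ⟩

/-- Menger's theorem in terms of partial injections: if `S` is not separated from `T` by fewer than
`|S|` vertices, there is an injection along edges on a finite set whose orbits lead from `S`
to `T`. -/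
theorem exists_linkage_s19 (H : SimpleGraph V) (S : Finset V) (T : Set V)
    (h : ∀ s : FinSep H, ↑S ⊆ s.1.A → T ⊆ s.1.B → S.card ≤ (s.1.A ∩ s.1.B).ncard) :
    ∃ U : Finset V, S ⊆ U ∧ ∃ g : V → V, InjOn g (↑U \ T) ∧
      ∀ v ∈ U, v ∉ T → g v ∈ U ∧ g v ∉ S ∧ (g v = v ∨ H.Adj v (g v)) := by
  classical
  by_contra hcon
  have hall : ∀ U : Finset V, ∃ A W : Finset V, S ⊆ A ∧ W ⊆ A ∧ (∀ v ∈ W, v ∉ T) ∧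
      (A \ W).card < S.card ∧ ∀ a ∈ W, ∀ b ∈ U, H.Adj a b → b ∈ A := by
    intro U
    let t : {v // v ∈ U ∪ S ∧ v ∉ T} → Finset V := fun v =>
      (U ∪ S).filter fun u => u ∉ S ∧ (u = v ∨ H.Adj v u)
    have hW : ∃ W : Finset {v // v ∈ U ∪ S ∧ v ∉ T}, (W.biUnion t).card < W.card := by
      by_contra hno
      push Not at hno
      obtain ⟨f, hf, hft⟩ := (Finset.all_card_le_biUnion_card_iff_exists_injective t).1 hno
      refine hcon ⟨U ∪ S, Finset.subset_union_right,
        fun v => if hv : v ∈ U ∪ S ∧ v ∉ T then f ⟨v, hv⟩ else v, ?_, ?_⟩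
      · intro v hv w hw hvw
        have hv' : v ∈ U ∪ S ∧ v ∉ T := ⟨Finset.mem_coe.1 hv.1, hv.2⟩
        have hw' : w ∈ U ∪ S ∧ w ∉ T := ⟨Finset.mem_coe.1 hw.1, hw.2⟩
        simp only [dif_pos hv', dif_pos hw'] at hvw
        exact congrArg Subtype.val (hf hvw)
      · intro v hvU hvT
        have hv' : v ∈ U ∪ S ∧ v ∉ T := ⟨hvU, hvT⟩
        have := hft ⟨v, hv'⟩
        simp only [t, Finset.mem_filter] at this
        simpa only [dif_pos hv'] using this
    obtain ⟨W, hW⟩ := hW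
    let W' : Finset V := W.map (Function.Embedding.subtype _)
    have hWA : W' ⊆ S ∪ W.biUnion t := by
      intro v hv
      obtain ⟨v, hvW, rfl⟩ := Finset.mem_map.1 hv
      by_cases hvS : (v : V) ∈ S
      · exact Finset.mem_union_left _ hvS
      · exact Finset.mem_union_right _ (Finset.mem_biUnion.2
          ⟨v, hvW, Finset.mem_filter.2 ⟨v.2.1, hvS, Or.inl rfl⟩⟩)
    refine ⟨S ∪ W.biUnion t, W', Finset.subset_union_left, hWA, ?_, ?_, ?_⟩
    · intro v hv
      obtain ⟨v, -, rfl⟩ := Finset.mem_map.1 hv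
      exact v.2.2
    · have h1 := Finset.card_sdiff_add_card_eq_card hWA
      have h2 := Finset.card_union_le S (W.biUnion t)
      have h3 : W'.card = W.card := Finset.card_map _
      omega
    · intro a ha b hb hab
      obtain ⟨a, haW, rfl⟩ := Finset.mem_map.1 ha
      by_cases hbS : b ∈ S
      · exact Finset.mem_union_left _ hbS
      · exact Finset.mem_union_right _ (Finset.mem_biUnion.2 ⟨a, haW,
          Finset.mem_filter.2 ⟨Finset.mem_union_left _ hb, hbS, Or.inr hab⟩⟩)
  choose A W hSA hWA hWT hcard hadj using hall
  let 𝒰 : Ultrafilter (Finset V) := Ultrafilter.of Filter.atTop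
  have hlarge : ∀ b : V, ∀ᶠ U in (𝒰 : Filter (Finset V)), b ∈ U := fun b =>
    Ultrafilter.of_le _ ((Filter.eventually_ge_atTop {b}).mono fun U hU =>
      hU (Finset.mem_singleton_self b))
  let A' : Set V := {v | ∀ᶠ U in (𝒰 : Filter (Finset V)), v ∈ A U}
  let B' : Set V := {v | ∀ᶠ U in (𝒰 : Filter (Finset V)), v ∉ W U}
  have hsmall : ∀ E : Finset V, ↑E ⊆ A' ∩ B' → E.card < S.card := by
    intro E hE
    have hev : ∀ᶠ U in (𝒰 : Filter (Finset V)), ∀ v ∈ E, v ∈ A U \ W U := by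
      rw [Filter.eventually_all_finset]
      intro v hv
      filter_upwards [(hE hv).1, (hE hv).2] with U h1 h2
      exact Finset.mem_sdiff.2 ⟨h1, h2⟩
    obtain ⟨U, hU⟩ := hev.exists
    exact (Finset.card_le_card hU).trans_lt (hcard U)
  have hfin : (A' ∩ B').Finite := by
    by_contra hinf
    obtain ⟨E, hE, hEc⟩ := Set.Infinite.exists_subset_card_eq hinf S.card
    exact (hsmall E hE).ne hEc
  have hunion : A' ∪ B' = univ := by
    refine eq_univ_of_forall fun v => ?_
    by_cases hv : v ∈ A'
    · exact Or.inl hv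
    · refine Or.inr ?_
      filter_upwards [Ultrafilter.eventually_not.2 hv] with U hU
      exact fun hW => hU (hWA U hW)
  have hno : ∀ a ∈ A' \ B', ∀ b ∈ B' \ A', ¬ H.Adj a b := by
    intro a ha b hb hab
    have h1 : ∀ᶠ U in (𝒰 : Filter (Finset V)), ¬ a ∉ W U := Ultrafilter.eventually_not.2 ha.2
    have h2 : ∀ᶠ U in (𝒰 : Filter (Finset V)), b ∉ A U := Ultrafilter.eventually_not.2 hb.2
    obtain ⟨U, h1, h2, h3⟩ := (h1.and (h2.and (hlarge b))).exists
    exact h2 (hadj U a (not_not.1 h1) b h3 hab)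
  have hle := h ⟨⟨A', B', hunion, hno⟩, hfin⟩
    (fun v hv => Filter.Eventually.of_forall fun U => hSA U hv)
    (fun v hv => Filter.Eventually.of_forall fun U hW => hWT U v hW hv)
  have hlt := hsmall hfin.toFinset (by simp)
  rw [← Set.ncard_eq_toFinset_card _ hfin] at hlt
  exact absurd hle (not_le.2 hlt)

/-- A separation over `D` of minimal order among those whose second side lies in its
second side. -/
structure TightOver (ω : GraphEnd G) (D : Set V) (s : FinSep G) : Prop
    extends SeparatesOver ω D s where
  order_le : ∀ t : FinSep G, SeparatesOver ω D t → t.1.B ⊆ s.1.B →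
    (s.1.A ∩ s.1.B).ncard ≤ (t.1.A ∩ t.1.B).ncard

theorem SeparatesOver.exists_tightOver {D : Set V} {s : FinSep G} (hs : SeparatesOver ω D s) :
    ∃ t : FinSep G, TightOver ω D t ∧ t.1.B ⊆ s.1.B := by
  classical
  have hex : ∃ n, ∃ t : FinSep G, SeparatesOver ω D t ∧ t.1.B ⊆ s.1.B ∧
      (t.1.A ∩ t.1.B).ncard = n := ⟨_, s, hs, subset_rfl, rfl⟩
  obtain ⟨t, ht, hts, hn⟩ := Nat.find_spec hex
  exact ⟨t, ⟨ht, fun t' ht' ht's => hn.le.trans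
    (Nat.find_min' hex ⟨t', ht', ht's.trans hts, rfl⟩)⟩, hts⟩

theorem TightOver.exists_tightOver_avoiding {D : Set V} (hD : D.Finite)
    (hdom : ∀ v, Dominates G v ω → v ∈ D) {s : FinSep G} (hs : TightOver ω D s) {Z : Set V}
    (hZ : Z.Finite) : ∃ t : FinSep G, TightOver ω D t ∧ t.1.B ⊆ s.1.B ∧ t.1.B ∩ Z ⊆ D := by
  obtain ⟨r, hr, hrZ⟩ := exists_separatesOver hD hdom hZ
  obtain ⟨t, ht, hts⟩ := (hs.toSeparatesOver.inf hr).exists_tightOver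
  exact ⟨t, ht, fun x hx => (hts hx).1, fun x hx => hrZ ⟨(hts hx.1).2, hx.2⟩⟩

/-- Every vertex of the separator outside `D` can reach a given ray of the end inside the second
side, avoiding `D`. -/
theorem TightOver.exists_walk {D : Set V} (hD : D.Finite) {s : FinSep G} (hs : TightOver ω D s)
    {R : GraphRay G} (hR : R ∈ ω.rays) {x : V} (hx : x ∈ s.1.A ∩ s.1.B) (hxD : x ∉ D) :
    ∃ n, ∃ w : G.Walk x (R.f n), ∀ y ∈ w.support, y ∈ s.1.B \ D := by
  let t := s.toward D (range R.f) hs.subset_A hs.subset_B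
  have ht : SeparatesOver ω D t :=
    ⟨s.toward_mem_endTangle hs.mem hD hR _ _ ⟨0, fun n _ => mem_range_self n⟩,
      fun y hy => Or.inl (hs.subset_A hy), fun y hy => Or.inl hy⟩
  have heq : t.1.A ∩ t.1.B = s.1.A ∩ s.1.B :=
    Set.eq_of_subset_of_ncard_le (s.toward_separator_subset hs.subset_A hs.subset_B)
      (hs.order_le t ht (s.toward_B_subset hs.subset_A hs.subset_B)) s.2
  have hxt : x ∈ t.1.B := (heq ▸ hx : x ∈ t.1.A ∩ t.1.B).2
  rcases hxt with h | ⟨_, ⟨n, rfl⟩, w, hw⟩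
  · exact absurd h hxD
  · exact ⟨n, w, hw⟩

theorem TightOver.exists_web {D : Set V} (hD : D.Finite) {s : FinSep G} (hs : TightOver ω D s)
    {R : GraphRay G} (hR : R ∈ ω.rays) :
    ∃ W : Set V, W.Finite ∧ W ⊆ s.1.B \ D ∧ ∀ x ∈ (s.1.A ∩ s.1.B) \ D,
      ∃ n, ∃ w : G.Walk x (R.f n), ∀ y ∈ w.support, y ∈ W := by
  have hex : ∀ x : ↥((s.1.A ∩ s.1.B) \ D), ∃ n, ∃ w : G.Walk x (R.f n),
      ∀ y ∈ w.support, y ∈ s.1.B \ D := fun x => hs.exists_walk hD hR x.2.1 x.2.2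
  choose n w hw using hex
  have : Finite ↥((s.1.A ∩ s.1.B) \ D) := (s.2.sdiff).to_subtype
  refine ⟨⋃ x, {y | y ∈ (w x).support}, finite_iUnion fun x => (w x).support.finite_toSet,
    iUnion_subset fun x y hy => hw x y hy, fun x hx => ⟨n ⟨x, hx⟩, w ⟨x, hx⟩, fun y hy => ?_⟩⟩
  exact mem_iUnion.2 ⟨⟨x, hx⟩, hy⟩

/-- The separator of a tight separation is linked, inside the second side, to every set containing
`D` and a tail of a ray of the end. -/
theorem TightOver.exists_linkage {D : Set V} {s : FinSep G} (hs : TightOver ω D s)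
    {R : GraphRay G} (hR : R ∈ ω.rays) {T : Set V} (hT : HasTailIn R T) (hDT : D ⊆ T) :
    ∃ U : Set V, U.Finite ∧ s.1.A ∩ s.1.B ⊆ U ∧ ∃ g : V → V, InjOn g (U \ T) ∧
      ∀ v ∈ U, v ∉ T → v ∈ s.1.B →
        g v ∈ U ∧ g v ∈ s.1.B ∧ g v ∉ s.1.A ∩ s.1.B ∧ (g v = v ∨ G.Adj v (g v)) := by
  let H : SimpleGraph V :=
    { Adj := fun a b => G.Adj a b ∧ a ∈ s.1.B ∧ b ∈ s.1.B
      symm := ⟨fun _ _ h => ⟨h.1.symm, h.2.2, h.2.1⟩⟩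
      loopless := ⟨fun _ h => h.1.ne rfl⟩ }
  obtain ⟨U, hSU, g, hg, hgU⟩ := _root_.exists_linkage_s19 H s.2.toFinset T (by
    intro r hSr hTr
    rw [Set.Finite.coe_toFinset] at hSr
    have hsub : (s.1.A ∪ r.1.A) ∩ (s.1.B ∩ r.1.B) ⊆ r.1.A ∩ r.1.B := by
      rintro x ⟨hx | hx, hxs, hxr⟩
      · exact ⟨hSr ⟨hx, hxs⟩, hxr⟩
      · exact ⟨hx, hxr⟩
    let t : FinSep G :=
      ⟨{ A := s.1.A ∪ r.1.A, B := s.1.B ∩ r.1.B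
         union_eq := by
          ext v
          have hs := s.1.mem_or v
          have ht := r.1.mem_or v
          simp only [mem_union, mem_inter_iff, mem_univ, iff_true]
          tauto
         no_edge := by
          rintro a ⟨-, ha⟩ b ⟨hbB, hb⟩ hab
          have haB : a ∈ s.1.B := s.1.mem_B_of_adj (fun h => hb (Or.inl h)) hab.symm
          exact hb (Or.inr (r.1.mem_A_of_adj (fun h => ha ⟨haB, h⟩) ⟨hab, haB, hbB.1⟩)) },
        r.2.subset hsub⟩
    have ht : SeparatesOver ω D t :=
      ⟨mem_endTangle_of_hasTailIn hR (by
          obtain ⟨N, hN⟩ := hs.mem R hR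
          obtain ⟨M, hM⟩ := hT
          exact ⟨max N M, fun n hn => ⟨hN n (by omega), hTr (hM n (by omega))⟩⟩),
        fun x hx => Or.inl (hs.subset_A hx), fun x hx => ⟨hs.subset_B hx, hTr (hDT hx)⟩⟩
    rw [← Set.ncard_eq_toFinset_card _ s.2]
    exact (hs.order_le t ht inter_subset_left).trans (Set.ncard_le_ncard hsub r.2))
  refine ⟨U, U.finite_toSet, fun x hx => hSU (by simpa using hx), g, hg, fun v hv hvT hvB => ?_⟩
  obtain ⟨h1, h2, h3⟩ := hgU v hv hvT
  refine ⟨h1, ?_, by simpa using h2, h3.imp_right fun h => h.1⟩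
  rcases h3 with h3 | h3
  · rwa [h3]
  · exact h3.2.2

/-- Linkages between consecutive separators concatenate to disjoint rays. -/
theorem exists_rays_of_linkages {D : Set V} (B S U : ℕ → Set V) (g : ℕ → V → V)
    (hB : ∀ i, B (i + 1) ⊆ B i) (hSU : ∀ i, S i ⊆ U i) (hSB : ∀ i, S i ⊆ B i)
    (hDS : ∀ i, D ⊆ S i) (hU : ∀ i, (U i).Finite) (hS : ∀ i, S i ∩ B (i + 1) ⊆ D)
    (hcross : ∀ i v w, v ∉ B i → w ∈ B i → G.Adj v w → w ∈ S i)
    (hinj : ∀ i, InjOn (g i) (U i \ B (i + 1)))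
    (hg : ∀ i, ∀ v ∈ U i, v ∉ B (i + 1) → v ∈ B i →
      g i v ∈ U i ∧ g i v ∈ B i ∧ g i v ∉ S i ∧ (g i v = v ∨ G.Adj v (g i v))) :
    ∃ R : ↥(S 0 \ D) → GraphRay G,
      (∀ x y, x ≠ y → Disjoint (range (R x).f) (range (R y).f)) ∧
      ∀ x i, ∃ n, (R x).f n ∈ S i \ D := by
  classical
  have hanti : ∀ i j, i ≤ j → B j ⊆ B i := fun i j hij => antitone_nat_of_succ_le hB hij
  let L : ℕ → V → Prop := fun i v => v ∈ U i ∧ v ∈ B i ∧ v ∉ B (i + 1) ∧ v ∉ D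
  have hLuniq : ∀ i j v, L i v → L j v → i = j := by
    intro i j v hi hj
    by_contra hne
    rcases lt_or_gt_of_ne hne with h | h
    · exact hi.2.2.1 (hanti (i + 1) j h hj.2.1)
    · exact hj.2.2.1 (hanti (j + 1) i h hi.2.1)
  let f : V → V := fun v => if h : ∃ i, L i v then g h.choose v else v
  have hf : ∀ i v, L i v → f v = g i v := by
    intro i v hi
    have h : ∃ i, L i v := ⟨i, hi⟩
    simp only [f, dif_pos h]
    rw [hLuniq _ _ v h.choose_spec hi]
  have hLS : ∀ i, ∀ v ∈ S i \ D, L i v := fun i v hv =>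
    ⟨hSU i hv.1, hSB i hv.1, fun h => hv.2 (hS i ⟨hv.1, h⟩), hv.2⟩
  have hfB : ∀ i v, L i v → f v ∈ B i ∧ f v ∉ S i ∧ f v ∉ D ∧ (f v = v ∨ G.Adj v (f v)) := by
    intro i v hi
    rw [hf i v hi]
    obtain ⟨-, h2, h3, h4⟩ := hg i v hi.1 hi.2.2.1 hi.2.1
    exact ⟨h2, h3, fun h => h3 (hDS i h), h4⟩
  have hfS : ∀ i v, L i v → f v ∈ B (i + 1) → f v ∈ S (i + 1) \ D := by
    intro i v hi hfv
    obtain ⟨h1, h2, h3, h4⟩ := hfB i v hi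
    rcases h4 with h4 | h4
    · exact absurd (h4 ▸ hfv) hi.2.2.1
    · exact ⟨hcross _ _ _ hi.2.2.1 hfv h4, h3⟩
  have hstep : ∀ i v, L i v → L i (f v) ∨ f v ∈ S (i + 1) \ D := by
    intro i v hi
    by_cases h : f v ∈ B (i + 1)
    · exact Or.inr (hfS i v hi h)
    · left
      refine ⟨?_, (hfB i v hi).1, h, (hfB i v hi).2.2.1⟩
      rw [hf i v hi]
      exact (hg i v hi.1 hi.2.2.1 hi.2.1).1
  have hfne : ∀ i j v w, L i v → L j w → i < j → f v ≠ f w := by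
    intro i j v w hi hj hij h
    have hw := hfB j w hj
    have hv := hfS i v hi (h ▸ hanti (i + 1) j hij hw.1)
    rcases Nat.lt_or_ge (i + 1) j with hlt | hge
    · exact hv.2 (hS (i + 1) ⟨hv.1, h ▸ hanti (i + 2) j hlt hw.1⟩)
    · obtain rfl : j = i + 1 := by omega
      exact hw.2.1 (h ▸ hv.1)
  have hfinj : ∀ v w, (∃ i, L i v) → (∃ j, L j w) → f v = f w → v = w := by
    rintro v w ⟨i, hi⟩ ⟨j, hj⟩ h
    rcases lt_trichotomy i j with hij | rfl | hij
    · exact absurd h (hfne i j v w hi hj hij)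
    · rw [hf i v hi, hf i w hj] at h
      exact hinj i ⟨hi.1, hi.2.2.1⟩ ⟨hj.1, hj.2.2.1⟩ h
    · exact absurd h.symm (hfne j i w v hj hi hij)
  have hfS0 : ∀ v, (∃ i, L i v) → f v ∉ S 0 := by
    rintro v ⟨i, hi⟩ hv
    obtain ⟨h1, h2, h3, -⟩ := hfB i v hi
    rcases Nat.eq_zero_or_pos i with rfl | hpos
    · exact h2 hv
    · exact h3 (hS 0 ⟨hv, hanti 1 i hpos h1⟩)
  have horb : ∀ x ∈ S 0 \ D, ∀ n, ∃ i, L i (f^[n] x) := by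
    intro x hx n
    induction n with
    | zero => exact ⟨0, hLS 0 x hx⟩
    | succ n ih =>
      obtain ⟨i, hi⟩ := ih
      rw [Function.iterate_succ_apply']
      rcases hstep i _ hi with h | h
      · exact ⟨i, h⟩
      · exact ⟨i + 1, hLS _ _ h⟩
  have hcancel : ∀ x ∈ S 0 \ D, ∀ y ∈ S 0 \ D, ∀ m n, f^[m] x = f^[n] y → m = n ∧ x = y := by
    intro x hx y hy m
    induction m with
    | zero =>
      intro n h
      cases n with
      | zero => exact ⟨rfl, h⟩
      | succ n =>
        rw [Function.iterate_succ_apply'] at h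
        exact absurd (h ▸ hx.1 : f (f^[n] y) ∈ S 0) (hfS0 _ (horb y hy n))
    | succ m ih =>
      intro n h
      cases n with
      | zero =>
        rw [Function.iterate_succ_apply'] at h
        exact absurd (h ▸ hy.1 : f (f^[m] x) ∈ S 0) (hfS0 _ (horb x hx m))
      | succ n =>
        rw [Function.iterate_succ_apply', Function.iterate_succ_apply'] at h
        obtain ⟨h1, h2⟩ := ih n (hfinj _ _ (horb x hx m) (horb y hy n) h)
        exact ⟨by rw [h1], h2⟩
  have horbinj : ∀ x ∈ S 0 \ D, Function.Injective fun n => f^[n] x :=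
    fun x hx m n h => (hcancel x hx x hx m n h).1
  refine ⟨fun x => ⟨fun n => f^[n] x, horbinj x x.2, fun n => ?_⟩, ?_, ?_⟩
  · obtain ⟨i, hi⟩ := horb x x.2 n
    rw [Function.iterate_succ_apply']
    refine (hfB i _ hi).2.2.2.resolve_left fun h => ?_
    rw [← Function.iterate_succ_apply' f] at h
    exact absurd (horbinj x x.2 h) (by omega)
  · intro x y hxy
    rw [Set.disjoint_left]
    rintro _ ⟨m, rfl⟩ ⟨n, h⟩
    exact hxy (Subtype.ext (hcancel y y.2 x x.2 n m h).2.symm)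
  · intro x i
    induction i with
    | zero => exact ⟨0, x.2⟩
    | succ i ih =>
      obtain ⟨n, hn⟩ := ih
      by_contra hcon
      push Not at hcon
      have hstay : ∀ m, L i (f^[n + m] x) := by
        intro m
        induction m with
        | zero => exact hLS i _ hn
        | succ m ihm =>
          rw [← Nat.add_assoc, Function.iterate_succ_apply']
          refine (hstep i _ ihm).resolve_right fun h => ?_
          rw [← Function.iterate_succ_apply' f] at h
          exact hcon (n + m + 1) h
      refine infinite_of_injective_forall_mem (f := fun m => f^[n + m] x) ?_
        (fun m => (hstay m).1) (hU i)
      intro m m' h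
      have := horbinj x x.2 h
      omega

/-- If `D` is a finite set containing all dominating vertices, the separator of a tight separation
over `D` sends disjoint rays of the end from its vertices outside `D`. -/
theorem TightOver.degGE {D : Set V} (hD : D.Finite) (hdom : ∀ v, Dominates G v ω → v ∈ D)
    {s : FinSep G} (hs : TightOver ω D s) {m : ℕ} (hm : m ≤ ((s.1.A ∩ s.1.B) \ D).ncard) :
    DegGE G ω m := by
  classical
  obtain ⟨R, hR⟩ := ω.nonempty
  have hnext : ∀ s : {s : FinSep G // TightOver ω D s}, ∃ (W : Set V)
      (t : {s : FinSep G // TightOver ω D s}) (U : Set V) (g : V → V),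
      (W ⊆ s.1.1.B \ D ∧ ∀ x ∈ (s.1.1.A ∩ s.1.1.B) \ D,
        ∃ n, ∃ w : G.Walk x (R.f n), ∀ y ∈ w.support, y ∈ W) ∧
      (t.1.1.B ⊆ s.1.1.B ∧ t.1.1.B ∩ (W ∪ s.1.1.A ∩ s.1.1.B) ⊆ D) ∧
      U.Finite ∧ s.1.1.A ∩ s.1.1.B ⊆ U ∧ InjOn g (U \ t.1.1.B) ∧
      ∀ v ∈ U, v ∉ t.1.1.B → v ∈ s.1.1.B → g v ∈ U ∧ g v ∈ s.1.1.B ∧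
        g v ∉ s.1.1.A ∩ s.1.1.B ∧ (g v = v ∨ G.Adj v (g v)) := by
    rintro ⟨s, hs⟩
    obtain ⟨W, hWfin, hWB, hW⟩ := hs.exists_web hD hR
    obtain ⟨t, ht, hts, htW⟩ := hs.exists_tightOver_avoiding hD hdom (hWfin.union s.2)
    obtain ⟨U, hU, hSU, g, hg, hgU⟩ := hs.exists_linkage hR (ht.mem R hR) ht.subset_B
    exact ⟨W, ⟨t, ht⟩, U, g, ⟨hWB, hW⟩, ⟨hts, htW⟩, hU, hSU, hg, hgU⟩
  choose W next U g hW hnext hU hSU hinj hg using hnext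
  let σ : ℕ → {s : FinSep G // TightOver ω D s} := fun n => next^[n] ⟨s, hs⟩
  have hσ : ∀ n, σ (n + 1) = next (σ n) := fun n => Function.iterate_succ_apply' _ _ _
  obtain ⟨Q, hQdisj, hQ⟩ := exists_rays_of_linkages (G := G) (D := D) (fun i => (σ i).1.1.B)
    (fun i => (σ i).1.1.A ∩ (σ i).1.1.B) (fun i => U (σ i)) (fun i => g (σ i))
    (fun i => by simpa only [hσ] using (hnext (σ i)).1)
    (fun i => hSU (σ i)) (fun i => inter_subset_right)
    (fun i x hx => ⟨(σ i).2.subset_A hx, (σ i).2.subset_B hx⟩) (fun i => hU (σ i))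
    (fun i x hx => (hnext (σ i)).2 ⟨by simpa only [hσ] using hx.2, Or.inr hx.1⟩)
    (fun i v w hv hw hvw => ⟨(σ i).1.1.mem_A_of_adj hv hvw, hw⟩)
    (fun i => by simpa only [hσ] using hinj (σ i))
    (fun i v hv hvB hvB' => hg (σ i) v hv (by simpa only [hσ] using hvB) hvB')
  have hanti : ∀ i j, i ≤ j → (σ j).1.1.B ⊆ (σ i).1.1.B := fun i j hij =>
    antitone_nat_of_succ_le (f := fun i => (σ i).1.1.B)
      (fun i => by simpa only [hσ] using (hnext (σ i)).1) hij
  have hWdisj : ∀ i j x, i < j → x ∈ W (σ i) → x ∉ W (σ j) := by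
    intro i j x hij hi hj
    have hxB := hanti (i + 1) j hij ((hW (σ j)).1 hj).1
    rw [hσ] at hxB
    exact ((hW (σ i)).1 hi).2 ((hnext (σ i)).2 ⟨hxB, Or.inl hi⟩)
  have hQω : ∀ x, Q x ∈ ω.rays := by
    intro x
    refine (ω.mem_iff R hR _).2 fun F hF => ?_
    have havoid : ∃ i, ∀ y ∈ W (σ i), y ∉ F := by
      by_contra hcon
      push Not at hcon
      choose c hcW hcF using hcon
      refine infinite_of_injective_forall_mem (f := c) (fun i j hij => ?_) hcF hF
      by_contra hne
      rcases lt_or_gt_of_ne hne with h | h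
      · exact hWdisj i j _ h (hcW i) (hij ▸ hcW j)
      · exact hWdisj j i _ h (hcW j) (hij ▸ hcW i)
    obtain ⟨i, hi⟩ := havoid
    obtain ⟨n, hn⟩ := hQ x i
    obtain ⟨k, w, hw⟩ := (hW (σ i)).2 _ hn
    exact ⟨k, n, w.reverse, fun y hy => hi y (hw y (by simpa using hy))⟩
  have hfin : ((s.1.A ∩ s.1.B) \ D).Finite := s.2.sdiff
  rw [Set.ncard_eq_toFinset_card _ hfin] at hm
  obtain ⟨E, hE, hEc⟩ := Finset.exists_subset_card_eq hm
  let e := (Finset.equivFinOfCardEq hEc).symm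
  have he : ∀ i, (e i : V) ∈ (s.1.A ∩ s.1.B) \ D := fun i => by
    simpa using hE (e i).2
  refine ⟨fun i => Q ⟨e i, he i⟩, fun i => hQω _, fun i j hij => hQdisj _ _ fun h => hij ?_⟩
  exact e.injective (Subtype.ext (Subtype.mk.inj h))

theorem DegDomGE.mono {j k : ℕ} (h : DegDomGE G ω k) (hjk : j ≤ k) : DegDomGE G ω j := by
  obtain ⟨m, n, rfl, ⟨R, hR, hdisj⟩, E, rfl, hE⟩ := h
  obtain ⟨E', hE', hc⟩ := Finset.exists_subset_card_eq (s := E) (n := j - min j m) (by omega)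
  refine ⟨min j m, j - min j m, by omega,
    ⟨fun i => R (Fin.castLE (min_le_right j m) i), fun i => hR _, fun i i' hii' => hdisj _ _ ?_⟩,
    E', hc, fun v hv => hE v (hE' hv)⟩
  exact fun h => hii' (Fin.castLE_injective _ h)

theorem DegDomGE.of_infinite (h : {v : V | Dominates G v ω}.Infinite) (k : ℕ) :
    DegDomGE G ω k := by
  obtain ⟨E, hE, hc⟩ := h.exists_subset_card_eq k
  exact ⟨0, k, by omega, ⟨fun i => i.elim0, fun i => i.elim0, fun i => i.elim0⟩, E, hc,
    fun v hv => hE hv⟩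

/-- The separation `(V, D)`. -/
def FinSep.coFinite (G : SimpleGraph V) {D : Set V} (hD : D.Finite) : FinSep G :=
  (FinSep.ofFinite G hD).rev

theorem FinSep.coFinite_notMem_endTangle {D : Set V} (hD : D.Finite) :
    FinSep.coFinite G hD ∉ endTangle ω := by
  intro h
  obtain ⟨R, hR⟩ := ω.nonempty
  obtain ⟨N, hN⟩ := h R hR
  obtain ⟨M, hM⟩ := R.exists_forall_notMem hD
  exact hM (max N M) (le_max_right _ _) (hN _ (le_max_left _ _))

theorem SeparatesOver.agrees_coFinite {D : Set V} (hD : D.Finite) {s : FinSep G}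
    (hs : SeparatesOver ω D s) {Z : Set V} (hZ : s.1.B ∩ Z ⊆ D) :
    s.1.A ∩ Z = (FinSep.coFinite G hD).1.A ∩ Z ∧ s.1.B ∩ Z = (FinSep.coFinite G hD).1.B ∩ Z := by
  have hA : (FinSep.coFinite G hD).1.A = univ := rfl
  have hB : (FinSep.coFinite G hD).1.B = D := rfl
  rw [hA, hB]
  constructor
  · ext x
    refine ⟨fun hx => ⟨mem_univ _, hx.2⟩, fun hx => ⟨?_, hx.2⟩⟩
    rcases s.1.mem_or x with h | h
    · exact h
    · exact hs.subset_A (hZ ⟨h, hx.2⟩)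
  · ext x
    exact ⟨fun hx => ⟨hZ hx, hx.2⟩, fun hx => ⟨hs.subset_B hx.1, hx.2⟩⟩

theorem isClosed_endTangle_iff :
    IsClosed (endTangle ω) ↔ {v : V | Dominates G v ω}.Infinite := by
  rw [isClosed_finSep_iff]
  constructor
  · intro h hD
    refine FinSep.coFinite_notMem_endTangle hD (ω := ω) (h _ fun Z hZ => ?_)
    obtain ⟨s, hs, hsZ⟩ := exists_separatesOver hD (fun v hv => hv) hZ
    exact ⟨s, hs.mem, hs.agrees_coFinite hD hsZ⟩
  · intro hinf s hs
    by_contra hsω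
    refine hinf (s.2.subset fun v hv => ⟨hv.mem_B (rev_mem_endTangle hsω), ?_⟩)
    obtain ⟨t, ht, -, htB⟩ := hs {v} (finite_singleton v)
    have : v ∈ t.1.B ∩ {v} := ⟨hv.mem_B ht, rfl⟩
    exact (htB ▸ this).1

theorem isClosed_order_lt_of_degDomGE {k : ℕ} (h : DegDomGE G ω k) :
    IsClosed {s : FinSep G | s ∈ endTangle ω ∧ (s.1.A ∩ s.1.B).ncard < k} := by
  classical
  rw [isClosed_finSep_iff]
  intro s hs
  constructor
  swap
  · obtain ⟨t, ht, htA, htB⟩ := hs _ s.2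
    refine lt_of_le_of_lt (Set.ncard_le_ncard ?_ t.2) ht.2
    intro x hx
    exact ⟨(htA ▸ ⟨hx.1, hx⟩ : x ∈ t.1.A ∩ (s.1.A ∩ s.1.B)).1,
      (htB ▸ ⟨hx.2, hx⟩ : x ∈ t.1.B ∩ (s.1.A ∩ s.1.B)).1⟩
  by_contra hsω
  have hrev := rev_mem_endTangle hsω
  obtain ⟨m, n, rfl, ⟨R, hR, hdisj⟩, E, rfl, hE⟩ := h
  have htail : ∀ i, ∃ N, (∀ n ≥ N, (R i).f n ∉ E) ∧ (R i).f N ∉ s.1.B := by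
    intro i
    obtain ⟨N, hN⟩ := (R i).exists_forall_notMem E.finite_toSet
    obtain ⟨M, hM⟩ := (R i).exists_forall_notMem s.2
    obtain ⟨K, hK⟩ := hrev (R i) (hR i)
    refine ⟨max N (max M K), fun n hn => hN n (by omega), fun hB => ?_⟩
    exact hM (max N (max M K)) (by omega) ⟨hK _ (by omega), hB⟩
  choose N hNE hNB using htail
  obtain ⟨t, ⟨ht, htk⟩, htA, htB⟩ := hs (↑E ∪ range fun i => (R i).f (N i))
    (E.finite_toSet.union (finite_range _))
  have hcross : ∀ i, ∃ n, N i ≤ n ∧ (R i).f n ∈ t.1.A ∩ t.1.B := by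
    intro i
    by_contra hcon
    push Not at hcon
    obtain ⟨M, hM⟩ := ht (R i) (hR i)
    have hstart : (R i).f (N i) ∉ t.1.B := by
      intro h
      have : (R i).f (N i) ∈ t.1.B ∩ (↑E ∪ range fun i => (R i).f (N i)) :=
        ⟨h, Or.inr ⟨i, rfl⟩⟩
      rw [htB] at this
      exact hNB i this.1
    have hnot : ∀ n ≥ N i, (R i).f n ∉ t.1.B := by
      intro n hn
      induction n, hn using Nat.le_induction with
      | base => exact hstart
      | succ n hn ih =>
        exact fun h => hcon (n + 1) (by omega) ⟨t.1.mem_A_of_adj ih ((R i).adj n), h⟩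
    exact hnot (max (N i) M) (le_max_left _ _) (hM _ (le_max_right _ _))
  choose c hcN hc using hcross
  have hcinj : Function.Injective fun i => (R i).f (c i) := by
    intro i j hij
    by_contra hne
    exact Set.disjoint_left.1 (hdisj i j hne) (mem_range_self (c i)) ⟨c j, hij.symm⟩
  let C : Finset V := Finset.univ.image fun i => (R i).f (c i)
  have hCE : Disjoint C E := by
    rw [Finset.disjoint_left]
    intro x hx hxE
    obtain ⟨i, -, rfl⟩ := Finset.mem_image.1 hx
    exact hNE i _ (hcN i) hxE
  have hsub : ↑(C ∪ E) ⊆ t.1.A ∩ t.1.B := by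
    intro x hx
    rcases Finset.mem_union.1 (Finset.mem_coe.1 hx) with hx | hx
    · obtain ⟨i, -, rfl⟩ := Finset.mem_image.1 hx
      exact hc i
    · refine ⟨?_, (hE x hx).mem_B ht⟩
      have : x ∈ s.1.A ∩ (↑E ∪ range fun i => (R i).f (N i)) :=
        ⟨(hE x hx).mem_B hrev, Or.inl hx⟩
      rw [← htA] at this
      exact this.1
  have hle := Set.ncard_le_ncard hsub t.2
  rw [Set.ncard_coe_finset, Finset.card_union_of_disjoint hCE,
    Finset.card_image_of_injective _ hcinj, Finset.card_univ, Fintype.card_fin] at hle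
  exact absurd htk (not_lt.2 hle)

theorem degDomGE_of_isClosed_order_lt {k : ℕ}
    (h : IsClosed {s : FinSep G | s ∈ endTangle ω ∧ (s.1.A ∩ s.1.B).ncard < k}) :
    DegDomGE G ω k := by
  by_cases hD : {v : V | Dominates G v ω}.Finite
  swap
  · exact DegDomGE.of_infinite hD k
  set D := {v : V | Dominates G v ω} with hDdef
  rw [isClosed_finSep_iff] at h
  have hex : ∃ Z : Set V, Z.Finite ∧ ∀ s : FinSep G, SeparatesOver ω D s → s.1.B ∩ Z ⊆ D →
      k ≤ (s.1.A ∩ s.1.B).ncard := by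
    by_contra hcon
    push Not at hcon
    refine FinSep.coFinite_notMem_endTangle hD (ω := ω) (h _ fun Z hZ => ?_).1
    obtain ⟨s, hs, hsZ, hsk⟩ := hcon Z hZ
    exact ⟨s, ⟨hs.mem, hsk⟩, hs.agrees_coFinite hD hsZ⟩
  obtain ⟨Z, hZ, hk⟩ := hex
  have hdom : ∀ v, Dominates G v ω → v ∈ D := fun v hv => hv
  obtain ⟨s, hs, hsZ⟩ := exists_separatesOver hD hdom hZ
  obtain ⟨t, ht, hts⟩ := hs.exists_tightOver
  have htk := hk t ht.toSeparatesOver fun x hx => hsZ ⟨hts hx.1, hx.2⟩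
  have hDt : D ⊆ t.1.A ∩ t.1.B := subset_inter ht.subset_A ht.subset_B
  have hdeg : DegGE G ω (k - D.ncard) := ht.degGE hD hdom (by
    rw [Set.ncard_sdiff hDt hD]
    omega)
  refine DegDomGE.mono ⟨k - D.ncard, D.ncard, rfl, hdeg, hD.toFinset,
    (Set.ncard_eq_toFinset_card _ hD).symm, fun v hv => by simpa [hDdef] using hv⟩ (by omega)

end CohesionLemmas

/-- an end has infinite cohesion (its end tangle is closed) iff
it is dominated by infinitely many vertices, and it has bounded cohesion
`coh(ω) = k` iff `deg(ω) + dom(ω) = k − 1`. -/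
theorem cohesion_characterisation {V : Type u} (G : SimpleGraph V) (ω : GraphEnd G) :
    (IsClosed (endTangle ω) ↔ {v : V | Dominates G v ω}.Infinite) ∧
    ∀ k : ℕ, 1 ≤ k →
      (((∀ j : ℕ, j < k →
          IsClosed {s : FinSep G | s ∈ endTangle ω ∧ (s.1.A ∩ s.1.B).ncard < j}) ∧
        ¬ IsClosed {s : FinSep G | s ∈ endTangle ω ∧ (s.1.A ∩ s.1.B).ncard < k}) ↔
       (DegDomGE G ω (k - 1) ∧ ¬ DegDomGE G ω k)) := by
  refine ⟨isClosed_endTangle_iff, fun k hk => ?_⟩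
  have hiff : ∀ j : ℕ,
      IsClosed {s : FinSep G | s ∈ endTangle ω ∧ (s.1.A ∩ s.1.B).ncard < j} ↔ DegDomGE G ω j :=
    fun j => ⟨degDomGE_of_isClosed_order_lt, isClosed_order_lt_of_degDomGE⟩
  simp only [hiff]
  exact and_congr_left fun _ =>
    ⟨fun h => h (k - 1) (by omega), fun h j hj => h.mono (by omega)⟩
end
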